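/- arXiv:2512.00720 — 2 statements merged into one kernel-verified Lean document; each statement's English description precedes it below -/
import Mathlib

section
/- Consider activated random walk on ℤ with simple symmetric nearest-neighbor jumps. For every integer k ≥ 1 there exist a constant C_k > 0 and λ₀ > 1 such that for all λ ≥ λ₀, setting r_k = Σ_{j=0}^{k} λ^j, for all finite V ⊂ ℤ with V ⊇ B_{r_k} and all all-active configurations η filling B_{r_k}, P(0 ∉ Stab_V η) ≤ C_k · λ^{−(k+1)} · (log λ)^k, where B_r = {x ∈ ℤ : |x| ≤ r}. -/
/-!
Common framework for the activated random walk (ARW) model on `ℤ^d`,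
via the site-wise (Diaconis–Fulton) representation.
-/

open MeasureTheory ENNReal Filter

namespace ARW

noncomputable section
open scoped Classical

/-- A site of the lattice `ℤ^d`. -/
abbrev Site (d : ℕ) := Fin d → ℤ

/-- An instruction: `none` is a sleep instruction, `some z` is a jump instruction
with displacement `z`. -/
abbrev Instr (d : ℕ) := Option (Site d)

instance (d : ℕ) : MeasurableSpace (Instr d) := ⊤

/-- The array of instruction stacks: `I (x, k)` is the `k`-th instruction at site `x`. -/
abbrev Stacks (d : ℕ) := Site d × ℕ → Instr d

/-- The state of a site: `active n` means `n` active particles (and no sleeping one),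
`sleeping` means a single sleeping particle. -/
inductive SiteState : Type
  | active : ℕ → SiteState
  | sleeping : SiteState
  deriving DecidableEq

/-- A particle configuration. -/
abbrev Config (d : ℕ) := Site d → SiteState

/-- Number of active particles at a site state. -/
def numActive : SiteState → ℕ
  | .active n => n
  | .sleeping => 0

/-- Adding one (active) particle to a site: a sleeping particle is reactivated. -/
def addParticle : SiteState → SiteState
  | .active n => .active (n + 1)
  | .sleeping => .active 2

/-- A state of the system: a configuration together with an odometer
(number of instructions already used at each site). -/
abbrev State (d : ℕ) := Config d × (Site d → ℕ)

/-- Initial state on `V` obtained from an all-active particle count `η` (particles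
outside `V` are discarded), with odometer `0`. -/
def initState (d : ℕ) (V : Finset (Site d)) (η : Site d → ℕ) : State d :=
  (fun x => .active (if x ∈ V then η x else 0), fun _ => 0)

/-- Toppling the site `x` (inside `V`, particles jumping out of `V` are killed):
the next unused instruction at `x` is executed and the odometer at `x` increases by one.
A sleep instruction puts the particle at `x` to sleep if it is alone (otherwise it has
no effect), and a jump instruction moves one particle from `x` to `x + z`
(reactivating a sleeping particle there), killing it if `x + z ∉ V`. -/
def topple {d : ℕ} (V : Finset (Site d)) (I : Stacks d) (x : Site d) (s : State d) :
    State d :=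
  let σ := s.1
  let m := s.2
  let σ' : Config d :=
    match I (x, m x) with
    | none => if numActive (σ x) = 1 then Function.update σ x .sleeping else σ
    | some z =>
        let σ₁ := Function.update σ x (SiteState.active (numActive (σ x) - 1))
        if x + z ∈ V then Function.update σ₁ (x + z) (addParticle (σ₁ (x + z))) else σ₁
  (σ', Function.update m x (m x + 1))

/-- Running a sequence of topplings. -/
def run {d : ℕ} (V : Finset (Site d)) (I : Stacks d) : State d → List (Site d) → State d
  | s, [] => s
  | s, x :: l => run V I (topple V I x s) l

/-- Legality of a toppling sequence: every toppled site lies in `V` and holds at least one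
active particle when toppled. -/
def Legal {d : ℕ} (V : Finset (Site d)) (I : Stacks d) : State d → List (Site d) → Prop
  | _, [] => True
  | s, x :: l => x ∈ V ∧ 1 ≤ numActive (s.1 x) ∧ Legal V I (topple V I x s) l

/-- A configuration is stable in `V` if no site of `V` holds an active particle. -/
def Stable {d : ℕ} (V : Finset (Site d)) (σ : Config d) : Prop :=
  ∀ x ∈ V, numActive (σ x) = 0

/-- The stabilization of `η` in `V` terminates. -/
def StabCompletes {d : ℕ} (V : Finset (Site d)) (I : Stacks d) (η : Site d → ℕ) : Prop :=
  ∃ l, Legal V I (initState d V η) l ∧ Stable V (run V I (initState d V η) l).1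

/-- The stable configuration `Stab_V η` (well defined, independently of the chosen legal
toppling sequence, by the abelian property), when stabilization terminates. -/
def stabConfig {d : ℕ} (V : Finset (Site d)) (I : Stacks d) (η : Site d → ℕ) : Config d :=
  if h : StabCompletes V I η then (run V I (initState d V η) h.choose).1
  else fun _ => .active 0

/-- The event `0 ∈ Stab_V η`: stabilization of `η` in `V` ends with a sleeping particle
at the origin. -/
def SleepAt0 {d : ℕ} (V : Finset (Site d)) (I : Stacks d) (η : Site d → ℕ) : Prop :=
  StabCompletes V I η ∧ stabConfig V I η 0 = .sleeping

/-- The event `0 ∉ Stab_V η`: stabilization of `η` in `V` ends with the origin empty. -/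
def EmptyAt0 {d : ℕ} (V : Finset (Site d)) (I : Stacks d) (η : Site d → ℕ) : Prop :=
  StabCompletes V I η ∧ stabConfig V I η 0 ≠ .sleeping

/-- The limiting odometer of `η` at the origin: the supremum, over finite volumes `V` and
legal toppling sequences in `V`, of the number of topplings performed at the origin. -/
def odom0 {d : ℕ} (I : Stacks d) (η : Site d → ℕ) : ℕ∞ :=
  ⨆ (V : Finset (Site d)) (l : List (Site d)) (_ : Legal V I (initState d V η) l),
    (l.count 0 : ℕ∞)

/-! ### The random instructions -/

/-- The normalized sleep rate `λ_s = λ/(1+λ)`. -/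
def lamS (lam : ℝ) : ℝ := lam / (1 + lam)

/-- The normalized jump rate `λ_J = 1/(1+λ)`. -/
def lamJ (lam : ℝ) : ℝ := 1 / (1 + lam)

/-- The distribution of a single instruction: sleep with probability `λ_s`, jump by `z`
with probability `λ_J · step z`. -/
def instrWeight {d : ℕ} (step : Site d → ℝ) (lam : ℝ) : Instr d → ℝ≥0∞
  | none => ENNReal.ofReal (lamS lam)
  | some z => ENNReal.ofReal (lamJ lam) * ENNReal.ofReal (step z)

/-- `μ` is the law of the i.i.d. instruction stacks: a probability measure whose
finite-dimensional cylinder probabilities are the products of the `instrWeight`s. -/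
def IsStackLaw (d : ℕ) (step : Site d → ℝ) (lam : ℝ) (μ : Measure (Stacks d)) : Prop :=
  IsProbabilityMeasure μ ∧
    ∀ (F : Finset (Site d × ℕ)) (g : Site d × ℕ → Instr d),
      μ {I | ∀ i ∈ F, I i = g i} = ∏ i ∈ F, instrWeight step lam (g i)

/-- The law of the i.i.d. instruction stacks (uniquely determined by its cylinder
probabilities; it exists whenever `step` is a probability distribution and `λ > 0`). -/
def stackLaw (d : ℕ) (step : Site d → ℝ) (lam : ℝ) : Measure (Stacks d) :=
  if h : ∃ μ, IsStackLaw d step lam μ then h.choose else 0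

/-! ### Fixation and the critical density -/

/-- Translation of a particle count by `z`. -/
def shift {d : ℕ} (z : Site d) (η : Site d → ℕ) : Site d → ℕ := fun x => η (x + z)

/-- A translation-ergodic distribution of particles: invariant under all translations,
and every translation-invariant event is trivial. -/
def IsTransErgodic {d : ℕ} (ν : Measure (Site d → ℕ)) : Prop :=
  (∀ z, Measure.map (shift z) ν = ν) ∧
    ∀ s : Set (Site d → ℕ), MeasurableSet s → (∀ z, shift z ⁻¹' s = s) → ν s = 0 ∨ ν s = 1

/-- Almost sure fixation of the initial distribution `ν`: for `ν`-almost every initial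
configuration and almost every instructions, the limiting odometer at the origin is
finite (equivalently, by Amir–Gurel-Gurevich, every particle eventually sleeps forever). -/
def Fixates (d : ℕ) (step : Site d → ℝ) (lam : ℝ) (ν : Measure (Site d → ℕ)) : Prop :=
  ∀ᵐ η ∂ν, ∀ᵐ I ∂(stackLaw d step lam), odom0 I η ≠ ⊤

/-- The critical density `ρ_c(ℤ^d, P, λ)`: the supremum of the densities `ρ` such that
every translation-ergodic probability distribution of active particles with mean `ρ`
particles per site fixates almost surely. -/
def critDensity (d : ℕ) (step : Site d → ℝ) (lam : ℝ) : ℝ :=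
  sSup {ρ : ℝ | 0 ≤ ρ ∧
    ∀ ν : Measure (Site d → ℕ), IsProbabilityMeasure ν → IsTransErgodic ν →
      (∫⁻ η, (η 0 : ℝ≥0∞) ∂ν) = ENNReal.ofReal ρ → Fixates d step lam ν}

/-! ### Random walk quantities -/

/-- Simple symmetric nearest-neighbour step distribution on `ℤ^d`. -/
def ssrwStep (d : ℕ) : Site d → ℝ :=
  fun z => if (∑ i, (z i).natAbs) = 1 then (1 : ℝ) / (2 * d) else 0

/-- `psum w k` : position after the first `k` steps with increments `w`. -/
def psum {d n : ℕ} (w : Fin n → Site d) (k : ℕ) : Site d :=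
  ∑ i ∈ Finset.univ.filter (fun i : Fin n => (i : ℕ) < k), w i

/-- Probability of a given sequence of increments. -/
def pathProb {d n : ℕ} (step : Site d → ℝ) (w : Fin n → Site d) : ℝ := ∏ i, step (w i)

/-- `P(S_n = 0)` for the discrete-time walk started at `0`. -/
def probAt0 {d : ℕ} (step : Site d → ℝ) (n : ℕ) : ℝ :=
  ∑' w : Fin n → Site d, if psum w n = 0 then pathProb step w else 0

/-- The Green's function `G = Σ_{n ≥ 0} P(S_n = 0)` of the walk, valued in `[0, ∞]`.
The walk is transient iff `greenE step < ∞`. -/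
def greenE {d : ℕ} (step : Site d → ℝ) : ℝ≥0∞ :=
  ∑' n : ℕ, ENNReal.ofReal (probAt0 step n)

/-- Probability that the walk returns to `0` for the first time at time `n`, having
stayed inside `A` at all intermediate times. -/
def returnIn {d : ℕ} (step : Site d → ℝ) (A : Set (Site d)) (n : ℕ) : ℝ :=
  ∑' w : Fin n → Site d,
    if (∀ k, 0 < k → k < n → psum w k ≠ 0 ∧ psum w k ∈ A) ∧ psum w n = 0
    then pathProb step w else 0

/-- `P(τ = n)` where `τ` is the first return time to the origin. -/
def firstReturn {d : ℕ} (step : Site d → ℝ) (n : ℕ) : ℝ := returnIn step Set.univ n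

/-- The probability that the walk started at `0` exits `A` strictly before returning
to `0`. -/
def escProb {d : ℕ} (step : Site d → ℝ) (A : Set (Site d)) : ℝ :=
  ∑' n : ℕ, ∑' w : Fin (n + 1) → Site d,
    if (∀ k, 0 < k → k ≤ n → psum w k ≠ 0 ∧ psum w k ∈ A) ∧ psum w (n + 1) ∉ A
    then pathProb step w else 0

/-- `q(ℤ^d, P, λ)`: the probability that a single particle started at the origin falls
asleep at the origin, i.e. that the walk is at `0` after `N` steps where
`P(N = n) = λ_s λ_J^n`. -/
def qProb {d : ℕ} (step : Site d → ℝ) (lam : ℝ) : ℝ :=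
  ∑' n : ℕ, lamS lam * lamJ lam ^ n * probAt0 step n

/-- The ball `B_r = {x : ‖x‖₁ ≤ r}`. -/
def ball (d : ℕ) (r : ℝ) : Set (Site d) := {x | ((∑ i, (x i).natAbs : ℕ) : ℝ) ≤ r}

/-- `η` fills `A`: at least one particle at each site of `A`. -/
def Fills {d : ℕ} (η : Site d → ℕ) (A : Set (Site d)) : Prop := ∀ x ∈ A, 1 ≤ η x

/-! ### Weak stabilization, strong stabilization and the number of chances -/

/-- Legality of a weak toppling sequence (with respect to the origin): off the origin as
usual, while the origin may only be toppled if it holds at least two active particles. -/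
def WLegal {d : ℕ} (V : Finset (Site d)) (I : Stacks d) : State d → List (Site d) → Prop
  | _, [] => True
  | s, x :: l => x ∈ V ∧ (if x = 0 then 2 else 1) ≤ numActive (s.1 x) ∧
      WLegal V I (topple V I x s) l

/-- Weak stability in `V` with respect to the origin. -/
def WStable {d : ℕ} (V : Finset (Site d)) (σ : Config d) : Prop :=
  numActive (σ 0) ≤ 1 ∧ ∀ x ∈ V, x ≠ 0 → numActive (σ x) = 0

/-- The weak stabilization of a state (well defined by the abelian property whenever it
terminates). -/
def weakStab {d : ℕ} (V : Finset (Site d)) (I : Stacks d) (s : State d) : State d :=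
  if h : ∃ l, WLegal V I s l ∧ WStable V (run V I s l).1 then run V I s h.choose else s

/-- The jump-out step: the particle at the origin is acceptably toppled (consuming
instructions at the origin, ignoring the sleep instructions) until it jumps out. -/
def jumpOut {d : ℕ} (V : Finset (Site d)) (I : Stacks d) (s : State d) : State d :=
  if h : ∃ k, (I (0, s.2 0 + k)).isSome then
    let k := Nat.find h
    let z := (I (0, s.2 0 + k)).get (Nat.find_spec h)
    let σ₁ := Function.update s.1 0 (SiteState.active (numActive (s.1 0) - 1))
    let σ' := if (0 : Site d) + z ∈ V then
        Function.update σ₁ ((0 : Site d) + z) (addParticle (σ₁ ((0 : Site d) + z)))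
      else σ₁
    (σ', Function.update s.2 0 (s.2 0 + k + 1))
  else s

/-- The states of the strong stabilization of `η` on `V` with respect to the origin via
successive weak stabilizations: `procState j` is the state after the `(j+1)`-st weak
stabilization; as long as the origin holds an active particle, it is jumped out and the
configuration is weakly stabilized again. -/
def procState {d : ℕ} (V : Finset (Site d)) (I : Stacks d) (η : Site d → ℕ) :
    ℕ → State d
  | 0 => weakStab V I (initState d V η)
  | j + 1 =>
      let s := procState V I η j
      if 1 ≤ numActive (s.1 0) then weakStab V I (jumpOut V I s) else s

/-- The number of chances `Ch(η, V)`: the number of completed iterations of the strong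
stabilization procedure, i.e. the first `j` such that the origin is empty after the
`(j+1)`-st weak stabilization. -/
def chances {d : ℕ} (V : Finset (Site d)) (I : Stacks d) (η : Site d → ℕ) : ℕ∞ :=
  if h : ∃ j, numActive ((procState V I η j).1 0) = 0 then (Nat.find h : ℕ∞) else ⊤

/-- The `j`-th weakly stable configuration `η^W_j` (for `1 ≤ j`). -/
def weakConfig {d : ℕ} (V : Finset (Site d)) (I : Stacks d) (η : Site d → ℕ) (j : ℕ) :
    Config d :=
  (procState V I η (j - 1)).1

/-- The `j`-th sleep trial `b_j` (for `1 ≤ j`): whether the first instruction used in the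
`j`-th jump-out step is a sleep instruction. -/
def sleepTrial {d : ℕ} (V : Finset (Site d)) (I : Stacks d) (η : Site d → ℕ) (j : ℕ) :
    Prop :=
  I (0, (procState V I η (j - 1)).2 0) = none

/-- `a^n` for `n ∈ ℕ∞`, with `a^∞ = 0` (appropriate for `a < 1`). -/
def enpow (a : ℝ≥0∞) : ℕ∞ → ℝ≥0∞
  | ⊤ => 0
  | (n : ℕ) => a ^ n

end
end ARW

open MeasureTheory ENNReal Filter Topology ARW

namespace ARWProof

open scoped Classical

/-! ### Abelian property -/

/-- Effect on the site state of executing an instruction there (before arrival). -/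
noncomputable def outSt {d : ℕ} (a : Instr d) (u : SiteState) : SiteState :=
  match a with
  | none => if numActive u = 1 then .sleeping else u
  | some _ => .active (numActive u - 1)

/-- Arrival of a particle at `w` when `a` is executed at `x`. -/
def Arr {d : ℕ} (V : Finset (Site d)) (x : Site d) (a : Instr d) (w : Site d) : Prop :=
  ∃ z, a = some z ∧ x + z ∈ V ∧ x + z = w

/-- One step on configurations. -/
noncomputable def stepC {d : ℕ} (V : Finset (Site d)) (x : Site d) (a : Instr d)
    (σ : Config d) : Config d := fun w =>
  if Arr V x a w then addParticle (if w = x then outSt a (σ w) else σ w)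
  else (if w = x then outSt a (σ w) else σ w)

theorem topple_eq {d : ℕ} (V : Finset (Site d)) (I : Stacks d) (x : Site d) (s : State d) :
    topple V I x s =
      (stepC V x (I (x, s.2 x)) s.1, Function.update s.2 x (s.2 x + 1)) := by
  unfold topple
  refine Prod.ext ?_ rfl
  funext w
  simp only [stepC]
  cases h : I (x, s.2 x) with
  | none =>
    have : ¬ Arr V x (none : Instr d) w := by rintro ⟨z, hz, _⟩; cases hz
    simp only [this, if_false, outSt]
    by_cases hw : w = x
    · subst hw
      by_cases h1 : numActive (s.1 w) = 1 <;> simp [h1]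
    · by_cases h1 : numActive (s.1 x) = 1 <;> simp [h1, hw]
  | some z =>
    simp only [outSt]
    by_cases hV : x + z ∈ V
    · by_cases hw : x + z = w
      · have : Arr V x (some z) w := ⟨z, rfl, hV, hw⟩
        subst hw
        simp only [hV, if_true, this]
        simp only [Function.update_self]
        by_cases hx : x + z = x
        · rw [hx]; simp
        · simp [hx, Function.update_of_ne]
      · have : ¬ Arr V x (some z) w := by
          rintro ⟨z', hz, _, h2⟩; cases hz; exact hw h2
        simp only [hV, if_true, this, if_false]
        rw [Function.update_of_ne (Ne.symm hw)]
        by_cases hx : w = x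
        · subst hx; simp
        · simp [hx, Function.update_of_ne]
    · have : ¬ Arr V x (some z) w := by
          rintro ⟨z', hz, h1, _⟩; cases hz; exact hV h1
      simp only [hV, if_false, this]
      by_cases hx : w = x
      · subst hx; simp
      · simp [hx, Function.update_of_ne]

theorem add_out {d : ℕ} (a : Instr d) (u : SiteState) (h : 1 ≤ numActive u) :
    addParticle (outSt a u) = outSt a (addParticle u) := by
  cases u with
  | sleeping => simp [numActive] at h
  | active n =>
    simp only [numActive] at h
    cases a with
    | none =>
      simp only [outSt, numActive, addParticle]
      by_cases hn : n = 1
      · simp [hn]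
      · have : n ≠ 0 := by omega
        simp [hn, this]
    | some z =>
      simp only [outSt, numActive, addParticle]
      congr 1; omega

theorem stepC_comm {d : ℕ} (V : Finset (Site d)) (x y : Site d) (a b : Instr d)
    (σ : Config d) (hxy : x ≠ y) (hx : 1 ≤ numActive (σ x)) (hy : 1 ≤ numActive (σ y)) :
    stepC V y b (stepC V x a σ) = stepC V x a (stepC V y b σ) := by
  funext w
  simp only [stepC]
  by_cases h1 : w = x
  · subst h1
    by_cases h3 : Arr V w a w <;> by_cases h4 : Arr V y b w <;>
      simp [h3, h4, hxy, add_out _ _ hx]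
  · by_cases h2 : w = y
    · subst h2
      by_cases h3 : Arr V x a w <;> by_cases h4 : Arr V w b w <;>
        simp [h3, h4, h1, add_out _ _ hy]
    · by_cases h3 : Arr V x a w <;> by_cases h4 : Arr V y b w <;>
        simp [h3, h4, h1, h2]

theorem numActive_add (u : SiteState) : numActive u ≤ numActive (addParticle u) := by
  cases u <;> simp [numActive, addParticle]

theorem stepC_active {d : ℕ} (V : Finset (Site d)) (x y : Site d) (a : Instr d)
    (σ : Config d) (hxy : y ≠ x) : numActive (σ y) ≤ numActive (stepC V x a σ y) := by
  simp only [stepC, hxy, if_false]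
  split_ifs
  · exact numActive_add _
  · exact le_rfl

theorem topple_comm {d : ℕ} (V : Finset (Site d)) (I : Stacks d) (x y : Site d)
    (s : State d) (hxy : x ≠ y) (hx : 1 ≤ numActive (s.1 x)) (hy : 1 ≤ numActive (s.1 y)) :
    topple V I y (topple V I x s) = topple V I x (topple V I y s) := by
  simp only [topple_eq]
  refine Prod.ext ?_ ?_
  · simp only [Function.update_of_ne hxy, Function.update_of_ne hxy.symm]
    exact stepC_comm V x y _ _ _ hxy hx hy
  · simp only [Function.update_of_ne hxy, Function.update_of_ne hxy.symm]
    exact Function.update_comm hxy.symm _ _ _ |>.symm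

/-- Moving a legal toppling to the front of a stabilizing sequence. -/
theorem move_front {d : ℕ} (V : Finset (Site d)) (I : Stacks d) (x : Site d) (hxV : x ∈ V) :
    ∀ (l : List (Site d)) (s : State d), 1 ≤ numActive (s.1 x) → Legal V I s l →
      Stable V (run V I s l).1 →
      ∃ l', l'.length + 1 = l.length ∧ Legal V I (topple V I x s) l' ∧
        run V I (topple V I x s) l' = run V I s l
  | [], s, hx, _, hst => by
    have := hst x hxV
    simp only [run] at this
    omega
  | y :: l, s, hx, hl, hst => by
    obtain ⟨hyV, hy, hl⟩ := hl
    by_cases hxy : x = y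
    · subst hxy
      exact ⟨l, rfl, hl, rfl⟩
    · have hx' : 1 ≤ numActive ((topple V I y s).1 x) := by
        rw [topple_eq]; exact hx.trans (stepC_active V y x _ _ hxy)
      have hy' : 1 ≤ numActive ((topple V I x s).1 y) := by
        rw [topple_eq]; exact hy.trans (stepC_active V x y _ _ (Ne.symm hxy))
      obtain ⟨l', h1, h2, h3⟩ := move_front V I x hxV l (topple V I y s) hx' hl hst
      have hc := topple_comm V I x y s hxy hx hy
      refine ⟨y :: l', by simp [h1], ⟨hyV, hy', ?_⟩, ?_⟩
      · rw [hc]; exact h2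
      · simp only [run]; rw [hc]; exact h3

/-- A (configuration-dependent) toppling strategy. -/
structure Strat (d : ℕ) (V : Finset (Site d)) where
  f : Config d → Site d
  mem : ∀ σ, ¬ Stable V σ → f σ ∈ V
  act : ∀ σ, ¬ Stable V σ → 1 ≤ numActive (σ (f σ))

/-- State after `n` steps of the strategy. -/
noncomputable def proc {d : ℕ} {V : Finset (Site d)} (S : Strat d V) (I : Stacks d) :
    ℕ → State d → State d
  | 0, s => s
  | n + 1, s => if Stable V s.1 then s else proc S I n (topple V I (S.f s.1) s)

theorem proc_legal {d : ℕ} {V : Finset (Site d)} (S : Strat d V) (I : Stacks d) :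
    ∀ n s, ∃ l, Legal V I s l ∧ run V I s l = proc S I n s
  | 0, s => ⟨[], trivial, rfl⟩
  | n + 1, s => by
    by_cases h : Stable V s.1
    · exact ⟨[], trivial, by simp [proc, h, run]⟩
    · obtain ⟨l, h1, h2⟩ := proc_legal S I n (topple V I (S.f s.1) s)
      exact ⟨S.f s.1 :: l, ⟨S.mem _ h, S.act _ h, h1⟩, by simp [proc, h, run, h2]⟩

theorem proc_stab {d : ℕ} {V : Finset (Site d)} (S : Strat d V) (I : Stacks d) :
    ∀ n s l, Legal V I s l → Stable V (run V I s l).1 → l.length ≤ n →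
      proc S I n s = run V I s l
  | 0, s, l, _, _, hn => by
    have : l = [] := List.length_eq_zero_iff.mp (by omega)
    subst this; rfl
  | n + 1, s, l, hl, hst, hn => by
    by_cases h : Stable V s.1
    · cases l with
      | nil => simp [proc, h, run]
      | cons y l => exact absurd (h y hl.1) (by have := hl.2.1; omega)
    · obtain ⟨l', h1, h2, h3⟩ :=
        move_front V I (S.f s.1) (S.mem _ h) l s (S.act _ h) hl hst
      simp only [proc, h, if_false]
      rw [← h3]
      exact proc_stab S I n _ l' h2 (by rw [h3]; exact hst) (by omega)

/-- The site `x` is empty in the stabilization. -/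
def Em {d : ℕ} (V : Finset (Site d)) (η : Site d → ℕ) (x : Site d) : Set (Stacks d) :=
  {I | ∃ l, Legal V I (initState d V η) l ∧ Stable V (run V I (initState d V η) l).1 ∧
    (run V I (initState d V η) l).1 x = .active 0}

theorem emptyAt0_sub {d : ℕ} (V : Finset (Site d)) (η : Site d → ℕ) (h0 : 0 ∈ V) :
    {I | EmptyAt0 V I η} ⊆ Em V η 0 := by
  rintro I ⟨h, h2⟩
  have hs := h.choose_spec
  refine ⟨h.choose, hs.1, hs.2, ?_⟩
  rw [stabConfig, dif_pos h] at h2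
  have := hs.2 0 h0
  revert this h2
  cases (run V I (initState d V η) h.choose).1 0 with
  | sleeping => simp
  | active n => intro _ h; simp only [numActive] at h; rw [h]

/-- The event that the strategy has halted within `n` steps in a configuration
satisfying `P`. -/
def Ev {d : ℕ} {V : Finset (Site d)} (S : Strat d V) (P : Config d → Prop) (n : ℕ)
    (s : State d) : Set (Stacks d) :=
  {I | Stable V (proc S I n s).1 ∧ P (proc S I n s).1}

theorem Ev_sub_Em {d : ℕ} {V : Finset (Site d)} (S : Strat d V) (η : Site d → ℕ) (x : Site d)
    (n : ℕ) : Ev S (fun σ => σ x = .active 0) n (initState d V η) ⊆ Em V η x := by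
  rintro I ⟨h1, h2⟩
  obtain ⟨l, h3, h4⟩ := proc_legal S I n (initState d V η)
  exact ⟨l, h3, by rw [h4]; exact h1, by rw [h4]; exact h2⟩

theorem Em_eq_iUnion {d : ℕ} {V : Finset (Site d)} (S : Strat d V) (η : Site d → ℕ)
    (x : Site d) :
    Em V η x = ⋃ n, Ev S (fun σ => σ x = .active 0) n (initState d V η) := by
  apply subset_antisymm
  · rintro I ⟨l, h1, h2, h3⟩
    rw [Set.mem_iUnion]
    have := proc_stab S I l.length _ l h1 h2 le_rfl
    refine ⟨l.length, ?_, ?_⟩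
    · rw [this]; exact h2
    · simp only [this]; exact h3
  · exact Set.iUnion_subset fun n => Ev_sub_Em S η x n

theorem Ev_mono {d : ℕ} {V : Finset (Site d)} (S : Strat d V) (η : Site d → ℕ)
    (x : Site d) :
    Monotone fun n => Ev S (fun σ => σ x = .active 0) n (initState d V η) := by
  intro n m hnm I hI
  obtain ⟨h1, h2⟩ := hI
  have key : ∀ n s, Stable V (proc S I n s).1 → ∀ m, n ≤ m → proc S I m s = proc S I n s := by
    intro n
    induction n with
    | zero =>
      intro s hs m _
      cases m with
      | zero => rfl
      | succ m => simp only [proc] at hs ⊢; simp [hs]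
    | succ n ih =>
      intro s hs m hm
      obtain ⟨m, rfl⟩ : ∃ k, m = k + 1 := ⟨m - 1, by omega⟩
      by_cases h : Stable V s.1
      · simp [proc, h]
      · simp only [proc, h, if_false] at hs ⊢
        exact ih _ hs m (by omega)
  have := key n _ h1 m hnm
  exact ⟨by rw [this]; exact h1, by simp only [this]; exact h2⟩

/-! ### Probability of halting events -/

/-- Unit steps. -/
def e1 : Site 1 := fun _ => 1

/-- Value recursion for the halting events. -/
noncomputable def pr {V : Finset (Site 1)} (lam : ℝ) (S : Strat 1 V) (P : Config 1 → Prop) :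
    ℕ → Config 1 → ℝ
  | 0, σ => if Stable V σ ∧ P σ then 1 else 0
  | n + 1, σ => if Stable V σ then (if P σ then 1 else 0) else
      lamS lam * pr lam S P n (stepC V (S.f σ) none σ)
      + lamJ lam / 2 * pr lam S P n (stepC V (S.f σ) (some e1) σ)
      + lamJ lam / 2 * pr lam S P n (stepC V (S.f σ) (some (-e1)) σ)

/-- Real weight. -/
noncomputable def wt (lam : ℝ) (a : Instr 1) : ℝ := (instrWeight (ssrwStep 1) lam a).toReal

theorem wt_none {lam : ℝ} (h : 0 < lam) : wt lam none = lamS lam := by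
  simp only [wt, instrWeight]
  rw [ENNReal.toReal_ofReal]
  unfold lamS; positivity

theorem wt_e1 {lam : ℝ} (h : 0 < lam) : wt lam (some e1) = lamJ lam / 2 := by
  simp only [wt, instrWeight, ssrwStep, e1]
  have : 0 ≤ lamJ lam := by unfold lamJ; positivity
  simp [this]; ring

theorem wt_ne1 {lam : ℝ} (h : 0 < lam) : wt lam (some (-e1)) = lamJ lam / 2 := by
  simp only [wt, instrWeight, ssrwStep]
  have : 0 ≤ lamJ lam := by unfold lamJ; positivity
  have h1 : (e1 0) = 1 := rfl
  simp [this, h1]; ring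

/-- Cylinder sets. -/
def Cyl (F : Finset (Site 1 × ℕ)) (g : Site 1 × ℕ → Instr 1) : Set (Stacks 1) :=
  {I | ∀ i ∈ F, I i = g i}

theorem Cyl_real {lam : ℝ} {μ : Measure (Stacks 1)}
    (hμ : IsStackLaw 1 (ssrwStep 1) lam μ) (F) (g) :
    μ.real (Cyl F g) = ∏ i ∈ F, wt lam (g i) := by
  unfold Measure.real Cyl
  rw [hμ.2, ENNReal.toReal_prod]; rfl

theorem Cyl_insert (F : Finset (Site 1 × ℕ)) (g : Site 1 × ℕ → Instr 1) (i) (hi : i ∉ F) (a) :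
    Cyl F g ∩ {I | I i = a} = Cyl (insert i F) (Function.update g i a) := by
  ext I
  simp only [Cyl, Set.mem_inter_iff, Set.mem_ofPred_eq, Finset.forall_mem_insert,
    Function.update_self]
  rw [and_comm]
  refine and_congr_right fun _ => forall₂_congr fun j hj => ?_
  rw [Function.update_of_ne]
  rintro rfl; exact hi hj

theorem Cyl_insert_real {lam : ℝ} {μ : Measure (Stacks 1)}
    (hμ : IsStackLaw 1 (ssrwStep 1) lam μ)
    (F : Finset (Site 1 × ℕ)) (g : Site 1 × ℕ → Instr 1) (i) (hi : i ∉ F) (a) :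
    μ.real (Cyl (insert i F) (Function.update g i a)) = wt lam a * μ.real (Cyl F g) := by
  rw [Cyl_real hμ, Cyl_real hμ, Finset.prod_insert hi, Function.update_self]
  congr 1
  refine Finset.prod_congr rfl fun j hj => ?_
  rw [Function.update_of_ne]
  rintro rfl; exact hi hj

theorem meas_coord (i : Site 1 × ℕ) (a : Instr 1) :
    MeasurableSet {I : Stacks 1 | I i = a} := by
  have h : MeasurableSet (Set.preimage (fun I : Stacks 1 => I i) {a}) :=
    measurable_pi_apply i (show MeasurableSet[⊤] {a} from trivial)
  have h2 : {I : Stacks 1 | I i = a} = Set.preimage (fun I : Stacks 1 => I i) {a} := by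
    ext I; simp
  rw [h2]; exact h

theorem e1_ne : e1 ≠ -e1 := by
  intro h
  have := congrFun h 0
  simp [e1] at this

theorem split3 {lam : ℝ} (hlam : 0 < lam) {μ : Measure (Stacks 1)}
    (hμ : IsStackLaw 1 (ssrwStep 1) lam μ) (i : Site 1 × ℕ) (A : Set (Stacks 1)) :
    μ.real A = μ.real (A ∩ {I | I i = none}) + μ.real (A ∩ {I | I i = some e1})
      + μ.real (A ∩ {I | I i = some (-e1)}) := by
  have := hμ.1
  have h1 : ∀ a, μ.real {I | I i = a} = wt lam a := by
    intro a
    have := Cyl_insert_real hμ ∅ (fun _ => none) i (by simp) a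
    have h2 : Cyl (insert i ∅) (Function.update (fun _ => none) i a) = {I | I i = a} := by
      rw [← Cyl_insert _ _ _ (by simp)]; simp [Cyl]
    rw [h2] at this
    rw [this]; simp [Cyl]
  have g1 := measureReal_inter_add_sdiff (μ := μ) (s := A) (meas_coord i none)
  have g2 := measureReal_inter_add_sdiff (μ := μ) (s := A \ {I | I i = none})
    (meas_coord i (some e1))
  have g3 := measureReal_inter_add_sdiff (μ := μ)
    (s := (A \ {I | I i = none}) \ {I | I i = some e1}) (meas_coord i (some (-e1)))
  have h2 : (A \ {I : Stacks 1 | I i = none}) ∩ {I | I i = some e1} = A ∩ {I | I i = some e1} := by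
    ext I
    simp only [Set.mem_inter_iff, Set.mem_sdiff, Set.mem_ofPred_eq]
    constructor
    · tauto
    · rintro ⟨h, h'⟩; simp [h, h']
  have h3 : ((A \ {I : Stacks 1 | I i = none}) \ {I | I i = some e1}) ∩ {I | I i = some (-e1)}
      = A ∩ {I | I i = some (-e1)} := by
    ext I
    simp only [Set.mem_inter_iff, Set.mem_sdiff, Set.mem_ofPred_eq]
    constructor
    · tauto
    · rintro ⟨h, h'⟩; simp [h, h', e1_ne.symm]
  have h4 : μ.real (((A \ {I : Stacks 1 | I i = none}) \ {I | I i = some e1}) \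
      {I | I i = some (-e1)}) = 0 := by
    have hU : μ.real ({I : Stacks 1 | I i = none} ∪ {I | I i = some e1} ∪ {I | I i = some (-e1)})
        = 1 := by
      rw [measureReal_union _ (meas_coord _ _), measureReal_union _ (meas_coord _ _), h1, h1, h1,
        wt_none hlam, wt_e1 hlam, wt_ne1 hlam]
      · unfold lamS lamJ; field_simp; ring
      · rw [Set.disjoint_left]; intro I h h'
        simp only [Set.mem_ofPred_eq] at h h'
        rw [h] at h'; cases h'
      · rw [Set.disjoint_left]; intro I h h'
        simp only [Set.mem_ofPred_eq, Set.mem_union] at h h'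
        rw [h'] at h; simp [e1_ne.symm] at h
    have hc := probReal_compl_eq_one_sub (μ := μ)
      (((meas_coord i none).union (meas_coord i (some e1))).union (meas_coord i (some (-e1))))
    rw [hU, sub_self] at hc
    refine le_antisymm (hc ▸ measureReal_mono ?_) measureReal_nonneg
    intro I
    simp only [Set.mem_sdiff, Set.mem_ofPred_eq, Set.mem_compl_iff, Set.mem_union]
    tauto
  rw [h2] at g2
  rw [h3, h4] at g3
  linarith

theorem Ev_real {lam : ℝ} (hlam : 0 < lam) {μ : Measure (Stacks 1)}
    (hμ : IsStackLaw 1 (ssrwStep 1) lam μ) {V : Finset (Site 1)} (S : Strat 1 V)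
    (P : Config 1 → Prop) :
    ∀ n (s : State 1) (F : Finset (Site 1 × ℕ)) (g : Site 1 × ℕ → Instr 1),
      (∀ i ∈ F, i.2 < s.2 i.1) →
      μ.real (Cyl F g ∩ Ev S P n s) = μ.real (Cyl F g) * pr lam S P n s.1 := by
  intro n
  induction n with
  | zero =>
    intro s F g _
    by_cases h : Stable V s.1 ∧ P s.1
    · have : Ev S P 0 s = Set.univ := by ext I; simpa [Ev, proc] using h
      simp [this, pr, h]
    · have : Ev S P 0 s = ∅ := by ext I; simpa [Ev, proc] using h
      simp [this, pr, h]
  | succ n ih =>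
    intro s F g hF
    by_cases h : Stable V s.1
    · by_cases hP : P s.1
      · have : Ev S P (n + 1) s = Set.univ := by ext I; simp [Ev, proc, h, hP]
        simp [this, pr, h, hP]
      · have : Ev S P (n + 1) s = ∅ := by ext I; simp [Ev, proc, h, hP]
        simp [this, pr, h, hP]
    · set x := S.f s.1 with hx
      set i : Site 1 × ℕ := (x, s.2 x) with hi
      have hiF : i ∉ F := fun hh => by have := hF i hh; simp [hi] at this
      have key : ∀ a : Instr 1, μ.real (Cyl F g ∩ Ev S P (n + 1) s ∩ {I | I i = a}) =
          wt lam a * μ.real (Cyl F g) * pr lam S P n (stepC V x a s.1) := by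
        intro a
        have : Cyl F g ∩ Ev S P (n + 1) s ∩ {I | I i = a} =
            Cyl (insert i F) (Function.update g i a) ∩
              Ev S P n (stepC V x a s.1, Function.update s.2 x (s.2 x + 1)) := by
          rw [← Cyl_insert _ _ _ hiF]
          ext I
          simp only [Set.mem_inter_iff, Ev, Set.mem_ofPred_eq, proc, h, if_false, topple_eq,
            ← hx, ← hi]
          constructor
          · rintro ⟨⟨h1, h2⟩, h3⟩
            rw [h3] at h2; exact ⟨⟨h1, h3⟩, h2⟩
          · rintro ⟨⟨h1, h3⟩, h2⟩
            rw [h3]; exact ⟨⟨h1, h2⟩, rfl⟩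
        rw [this, ih, Cyl_insert_real hμ _ _ _ hiF]
        intro j hj
        rcases Finset.mem_insert.mp hj with rfl | hj
        · simp [hi]
        · have := hF j hj
          by_cases hjx : j.1 = x
          · simp only [hjx, Function.update_self]; rw [hjx] at this; omega
          · simpa only [Function.update_of_ne hjx] using this
      rw [split3 hlam hμ i, key, key, key, wt_none hlam, wt_e1 hlam, wt_ne1 hlam]
      simp only [pr, h, if_false]
      rw [← hx]; ring

/-! ### The potential function -/

/-- Distance to the centre. -/
def dl (c y : Site 1) : ℕ := (y 0 - c 0).natAbs

/-- A walker `y` inside a filled neighbourhood of radius `D`. -/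
def Valid (c : Site 1) (N : ℕ) (σ : Config 1) (y : Site 1) (D : ℕ) : Prop :=
  1 ≤ dl c y ∧ dl c y < D ∧ D ≤ N + 1 ∧
    (∀ x, 1 ≤ dl c x → dl c x < D → σ x ≠ .active 0) ∧ 2 ≤ numActive (σ y)

/-- Candidate values. -/
def Qs (c : Site 1) (N : ℕ) (σ : Config 1) : Set ℝ :=
  insert 1 {q | ∃ y D, Valid c N σ y D ∧ q = (dl c y : ℝ) / D}

theorem Qs_finite (c : Site 1) (N : ℕ) (σ : Config 1) : (Qs c N σ).Finite := by
  refine Set.Finite.insert _ ?_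
  refine Set.Finite.subset (((Finset.range (N + 2)) ×ˢ (Finset.range (N + 2))).image
    (fun p : ℕ × ℕ => (p.1 : ℝ) / p.2)).finite_toSet ?_
  rintro q ⟨y, D, hv, rfl⟩
  obtain ⟨h1, h2, h3, -⟩ := hv
  simp only [Finset.coe_image, Set.mem_image, Finset.mem_coe, Finset.mem_product,
    Finset.mem_range]
  exact ⟨(dl c y, D), ⟨by omega, by omega⟩, rfl⟩

theorem Qs_nonneg (c : Site 1) (N : ℕ) (σ : Config 1) (q : ℝ) (hq : q ∈ Qs c N σ) : 0 ≤ q := by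
  rcases hq with rfl | ⟨y, D, _, rfl⟩ <;> positivity

/-- The potential of configurations with empty centre. -/
noncomputable def Ps (c : Site 1) (N : ℕ) (σ : Config 1) : ℝ := sInf (Qs c N σ)

theorem Ps_mem (c : Site 1) (N : ℕ) (σ : Config 1) : Ps c N σ ∈ Qs c N σ :=
  Set.Nonempty.csInf_mem ⟨1, Set.mem_insert _ _⟩ (Qs_finite c N σ)

theorem Ps_le (c : Site 1) (N : ℕ) (σ : Config 1) (q : ℝ) (hq : q ∈ Qs c N σ) :
    Ps c N σ ≤ q := csInf_le ⟨0, fun r hr => Qs_nonneg c N σ r hr⟩ hq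

/-- Indicator of a hole. -/
noncomputable def hole (σ : Config 1) (x : Site 1) : ℝ := if σ x = .active 0 then 1 else 0

theorem hole_nonneg (σ : Config 1) (x : Site 1) : 0 ≤ hole σ x := by
  unfold hole; split_ifs <;> norm_num

/-- The site at displacement `n` from `c`. -/
def sh (c : Site 1) (n : ℤ) : Site 1 := fun _ => c 0 + n

/-- Weighted count of holes. -/
noncomputable def Hs (c : Site 1) (N : ℕ) (σ : Config 1) : ℝ :=
  1 / (N + 1 : ℝ) + ∑ i ∈ Finset.range N,
    (hole σ (sh c (i + 1)) + hole σ (sh c (-(i + 1)))) / (i + 1 : ℝ)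

theorem Hs_term_nonneg (c : Site 1) (σ : Config 1) (i : ℕ) :
    0 ≤ (hole σ (sh c (i + 1)) + hole σ (sh c (-(i + 1)))) / (i + 1 : ℝ) := by
  have := hole_nonneg σ (sh c (i + 1))
  have := hole_nonneg σ (sh c (-(i + 1)))
  positivity

theorem Hs_nonneg (c : Site 1) (N : ℕ) (σ : Config 1) : 0 ≤ Hs c N σ := by
  unfold Hs
  have := Finset.sum_nonneg (s := Finset.range N) fun i _ => Hs_term_nonneg c σ i
  positivity

/-- There is a good radius. -/
theorem exists_radius (c : Site 1) (N : ℕ) (σ : Config 1) :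
    ∃ D : ℕ, 1 ≤ D ∧ D ≤ N + 1 ∧ (∀ x, 1 ≤ dl c x → dl c x < D → σ x ≠ .active 0) ∧
      1 / (D : ℝ) ≤ Hs c N σ := by
  have hex : ∃ D, 1 ≤ D ∧ (D = N + 1 ∨ ∃ x, dl c x = D ∧ σ x = .active 0) :=
    ⟨N + 1, by omega, Or.inl rfl⟩
  have hs := Nat.find_spec hex
  have hm := fun {m : ℕ} => Nat.find_min hex (m := m)
  have hle : Nat.find hex ≤ N + 1 := Nat.find_le ⟨by omega, Or.inl rfl⟩
  refine ⟨Nat.find hex, hs.1, hle, ?_, ?_⟩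
  · intro x h1 h2 h3
    exact hm h2 ⟨h1, Or.inr ⟨x, rfl, h3⟩⟩
  · generalize Nat.find hex = D at *
    by_cases hD : D = N + 1
    · subst hD
      unfold Hs
      have := Finset.sum_nonneg (s := Finset.range N) fun i _ => Hs_term_nonneg c σ i
      push_cast; linarith
    · obtain ⟨h1, h2⟩ := hs
      rcases h2 with h2 | ⟨x, hx, hx0⟩
      · exact absurd h2 hD
      obtain ⟨i, rfl⟩ : ∃ i, D = i + 1 := ⟨D - 1, by omega⟩
      have hi : i ∈ Finset.range N := by simp; omega
      have hsum := Finset.single_le_sum (f := fun i : ℕ =>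
        (hole σ (sh c (i + 1)) + hole σ (sh c (-(i + 1)))) / (i + 1 : ℝ))
        (fun i _ => Hs_term_nonneg c σ i) hi
      have hone : (1 : ℝ) ≤ hole σ (sh c (i + 1)) + hole σ (sh c (-(i + 1))) := by
        have hxx : x = sh c (i + 1) ∨ x = sh c (-(i + 1)) := by
          unfold dl at hx
          have : x 0 = c 0 + (i + 1) ∨ x 0 = c 0 + (-(i + 1)) := by omega
          rcases this with h | h
          · left; funext j; fin_cases j; simpa [sh] using h
          · right; funext j; fin_cases j; simpa [sh] using h
        have a1 := hole_nonneg σ (sh c (i + 1))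
        have a2 := hole_nonneg σ (sh c (-(i + 1)))
        have a3 : hole σ x = 1 := by simp [hole, hx0]
        rcases hxx with h | h <;> rw [h] at a3 <;> linarith
      have : 1 / ((i + 1 : ℕ) : ℝ) ≤
          (hole σ (sh c (i + 1)) + hole σ (sh c (-(i + 1)))) / (i + 1 : ℝ) := by
        push_cast; gcongr
      unfold Hs
      have h0 : (0 : ℝ) ≤ 1 / (N + 1 : ℝ) := by positivity
      linarith

/-- The potential. -/
noncomputable def Psi (lam : ℝ) (V : Finset (Site 1)) (c : Site 1) (N : ℕ) (σ : Config 1) : ℝ :=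
  if σ c = .active 0 then Ps c N σ
  else if Stable V σ then -(Hs c N σ / lam) else 0

theorem Psi_le_one {lam : ℝ} (hlam : 0 < lam) (V c N σ) : Psi lam V c N σ ≤ 1 := by
  unfold Psi
  have := Hs_nonneg c N σ
  split_ifs
  · exact Ps_le _ _ _ _ (Set.mem_insert _ _)
  · have : 0 ≤ Hs c N σ / lam := by positivity
    linarith
  · norm_num

theorem Psi_le_zero {lam : ℝ} (hlam : 0 < lam) (V c N σ) (h : σ c ≠ .active 0) :
    Psi lam V c N σ ≤ 0 := by
  unfold Psi
  have := Hs_nonneg c N σ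
  have : 0 ≤ Hs c N σ / lam := by positivity
  rw [if_neg h]
  split_ifs <;> linarith

theorem add_ne (u : SiteState) : addParticle u ≠ .active 0 := by
  cases u <;> simp [addParticle]

theorem stepC_ne_zero {d : ℕ} (V : Finset (Site d)) (x w : Site d) (a : Instr d) (σ : Config d)
    (hw : σ w ≠ .active 0) (h : w = x → 2 ≤ numActive (σ w)) :
    stepC V x a σ w ≠ .active 0 := by
  simp only [stepC]
  split_ifs with h1 h2 h3
  · exact add_ne _
  · exact add_ne _
  · have := h h3
    cases a with
    | none =>
      have h5 : numActive (σ w) ≠ 1 := by omega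
      simp [outSt, h5, hw]
    | some z =>
      simp only [outSt, ne_eq, SiteState.active.injEq]; omega
  · exact hw

theorem lamSJ {lam : ℝ} (h : 0 < lam) : lamS lam + lamJ lam = 1 := by
  unfold lamS lamJ; field_simp; ring

/-- One jump of the walker. -/
theorem walker_jump {lam : ℝ} (hlam : 0 < lam) {V : Finset (Site 1)} {c : Site 1} {N : ℕ}
    (hV : ∀ x, dl c x ≤ N → x ∈ V) {σ : Config 1} {y : Site 1} {D : ℕ}
    (hv : Valid c N σ y D) (z : Site 1) (hz : (z 0).natAbs = 1) :
    Psi lam V c N (stepC V y (some z) σ) ≤ (dl c (y + z) : ℝ) / D := by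
  obtain ⟨h1, h2, h3, h4, h5⟩ := hv
  have hyc : y ≠ c := by rintro rfl; simp [dl] at h1
  have hd : dl c (y + z) ≤ dl c y + 1 := by
    simp only [dl, Pi.add_apply] at *; omega
  have hzy : y + z ≠ y := by
    intro h; have := congrFun h 0; simp only [Pi.add_apply] at this; omega
  have hDpos : (0 : ℝ) < D := by exact_mod_cast (by omega : 0 < D)
  by_cases hD : dl c (y + z) = D
  · rw [hD, div_self hDpos.ne']; exact Psi_le_one hlam _ _ _ _
  have hlt : dl c (y + z) < D := by omega
  have hyzV : y + z ∈ V := hV _ (by omega)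
  have harr : Arr V y (some z) (y + z) := ⟨z, rfl, hyzV, rfl⟩
  have hval : stepC V y (some z) σ (y + z) = addParticle (σ (y + z)) := by
    simp only [stepC, harr, if_true, hzy, if_false]
  by_cases h0 : dl c (y + z) = 0
  · have hcc : y + z = c := by
      funext j; fin_cases j; simp only [dl] at h0
      show (y + z) 0 = c 0
      omega
    rw [h0]
    simp only [Nat.cast_zero, zero_div]
    apply Psi_le_zero hlam
    rw [← hcc, hval]; exact add_ne _
  · have hnh : σ (y + z) ≠ .active 0 := h4 _ (by omega) hlt
    by_cases hc : stepC V y (some z) σ c = .active 0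
    · unfold Psi
      rw [if_pos hc]
      apply Ps_le
      by_cases hsl : 2 ≤ numActive (addParticle (σ (y + z)))
      · refine Or.inr ⟨y + z, D, ⟨by omega, hlt, h3, ?_, by rw [hval]; exact hsl⟩, rfl⟩
        intro x hx1 hx2
        refine stepC_ne_zero _ _ _ _ _ (h4 x hx1 hx2) ?_
        rintro rfl; exact h5
      · exfalso
        revert hsl hnh
        cases σ (y + z) with
        | sleeping => simp [addParticle, numActive]
        | active n => simp [addParticle, numActive]
    · refine (Psi_le_zero hlam _ _ _ _ hc).trans (by positivity)

theorem half_nonneg_of {a : ℝ} (h : 0 ≤ a) : 0 ≤ a / 2 := by linarith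

/-- The supermartingale property. -/
theorem good_move {lam : ℝ} (hlam : 0 < lam) (V : Finset (Site 1)) (c : Site 1) (N : ℕ)
    (hV : ∀ x, dl c x ≤ N → x ∈ V) (σ : Config 1) (hns : ¬ Stable V σ) :
    ∃ x, x ∈ V ∧ 1 ≤ numActive (σ x) ∧
      lamS lam * Psi lam V c N (stepC V x none σ)
      + lamJ lam / 2 * Psi lam V c N (stepC V x (some e1) σ)
      + lamJ lam / 2 * Psi lam V c N (stepC V x (some (-e1)) σ) ≤ Psi lam V c N σ := by
  have hS : 0 ≤ lamS lam := by unfold lamS; positivity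
  have hJ : 0 ≤ lamJ lam := by unfold lamJ; positivity
  have hSJ := lamSJ hlam
  have comb : ∀ a b d A : ℝ, a ≤ A → b ≤ A → d ≤ A →
      lamS lam * a + lamJ lam / 2 * b + lamJ lam / 2 * d ≤ A := by
    intro a b d A ha hb hd
    have e1 := mul_le_mul_of_nonneg_left ha hS
    have e2 := mul_le_mul_of_nonneg_left hb (half_nonneg_of hJ)
    have e3 := mul_le_mul_of_nonneg_left hd (half_nonneg_of hJ)
    have : lamS lam * A + lamJ lam / 2 * A + lamJ lam / 2 * A = A := by
      rw [show lamS lam * A + lamJ lam / 2 * A + lamJ lam / 2 * A =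
        (lamS lam + lamJ lam) * A by ring, hSJ, one_mul]
    linarith
  have hcV : c ∈ V := hV c (by simp [dl])
  have hns' : ∃ x ∈ V, 1 ≤ numActive (σ x) := by
    unfold Stable at hns; push Not at hns
    obtain ⟨x, hx, h⟩ := hns
    exact ⟨x, hx, by omega⟩
  by_cases hc : σ c = .active 0
  · have hPsi : Psi lam V c N σ = Ps c N σ := by simp [Psi, hc]
    rcases Ps_mem c N σ with h1 | ⟨y, D, hv, hq⟩
    · obtain ⟨x, hx, hxa⟩ := hns'
      refine ⟨x, hx, hxa, ?_⟩
      rw [hPsi, h1]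
      exact comb _ _ _ _ (Psi_le_one hlam _ _ _ _) (Psi_le_one hlam _ _ _ _)
        (Psi_le_one hlam _ _ _ _)
    · have hv' := hv
      obtain ⟨v1, v2, v3, v4, v5⟩ := hv'
      refine ⟨y, hV y (by omega), by omega, ?_⟩
      have hsl : stepC V y none σ = σ := by
        funext w
        have : ¬ Arr V y (none : Instr 1) w := by rintro ⟨z, hz, _⟩; cases hz
        simp only [stepC, this, if_false]
        split_ifs with h
        · subst h
          have h5 : numActive (σ w) ≠ 1 := by omega
          simp [outSt, h5]
        · rfl
      have j1 := walker_jump hlam hV hv e1 (by simp [e1])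
      have j2 := walker_jump hlam hV hv (-e1) (by simp [e1])
      have hDpos : (0 : ℝ) < D := by exact_mod_cast (by omega : 0 < D)
      have hsum : (dl c (y + e1) : ℝ) + dl c (y + -e1) = 2 * dl c y := by
        have : dl c (y + e1) + dl c (y + -e1) = 2 * dl c y := by
          simp only [dl, e1, Pi.add_apply, Pi.neg_apply] at *; omega
        exact_mod_cast this
      rw [hsl, hPsi, hq]
      have hj : lamJ lam / 2 * ((dl c (y + e1) : ℝ) / D) + lamJ lam / 2 * ((dl c (y + -e1) : ℝ) / D)
          = lamJ lam * ((dl c y : ℝ) / D) := by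
        rw [← mul_add, ← add_div, hsum]; ring
      have e2 := mul_le_mul_of_nonneg_left j1 (half_nonneg_of hJ)
      have e3 := mul_le_mul_of_nonneg_left j2 (half_nonneg_of hJ)
      have : lamS lam * ((dl c y : ℝ) / D) + lamJ lam * ((dl c y : ℝ) / D) = (dl c y : ℝ) / D := by
        rw [← add_mul, hSJ, one_mul]
      linarith
  · have hPsi : Psi lam V c N σ = 0 := by simp [Psi, hc, hns]
    rw [hPsi]
    by_cases hw : ∃ x ∈ V, 1 ≤ numActive (σ x) ∧ (c = x → 2 ≤ numActive (σ c))
    · obtain ⟨x, hx, hxa, h2⟩ := hw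
      refine ⟨x, hx, hxa, ?_⟩
      have := fun a => Psi_le_zero hlam V c N _ (stepC_ne_zero V x c a σ hc h2)
      exact comb _ _ _ _ (this _) (this _) (this _)
    · push Not at hw
      obtain ⟨x, hx, hxa⟩ := hns'
      obtain ⟨rfl, h2⟩ := hw x hx hxa
      have hc1 : σ c = .active 1 := by
        revert hxa h2
        cases σ c with
        | sleeping => simp [numActive]
        | active n => simp only [numActive, SiteState.active.injEq]; omega
      have hst : ∀ x ∈ V, x ≠ c → numActive (σ x) = 0 := by
        intro x hx hne
        by_contra h
        exact hne (hw x hx (by omega)).1.symm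
      refine ⟨c, hx, hxa, ?_⟩
      -- sleep
      have s1 : ∀ w, stepC V c none σ w = if w = c then .sleeping else σ w := by
        intro w
        have : ¬ Arr V c (none : Instr 1) w := by rintro ⟨z, hz, _⟩; cases hz
        simp only [stepC, this, if_false]
        split_ifs with h
        · subst h; simp [outSt, hc1, numActive]
        · rfl
      have shc : ∀ n : ℤ, n ≠ 0 → sh c n ≠ c := by
        intro n hn h
        have := congrFun h 0
        simp [sh] at this; exact hn this
      have s2 : Psi lam V c N (stepC V c none σ) = -(Hs c N σ / lam) := by
        have t1 : Stable V (stepC V c none σ) := by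
          intro w hw
          rw [s1]; split_ifs with h
          · rfl
          · exact hst w hw h
        have t2 : Hs c N (stepC V c none σ) = Hs c N σ := by
          unfold Hs hole
          congr 1
          refine Finset.sum_congr rfl fun i _ => ?_
          rw [s1, s1, if_neg (shc _ (by omega)), if_neg (shc _ (by omega))]
        have t3 : stepC V c none σ c ≠ .active 0 := by rw [s1]; simp
        simp only [Psi, t3, t1, if_true, if_false, t2]
      have s3 : ∀ z : Site 1, (z 0).natAbs = 1 →
          Psi lam V c N (stepC V c (some z) σ) ≤ Hs c N σ := by
        intro z hz
        obtain ⟨D, d1, d2, d3, d4⟩ := exists_radius c N σ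
        refine le_trans ?_ d4
        by_cases hD : D = 1
        · subst hD; simpa using Psi_le_one hlam V c N _
        have hzd : dl c (c + z) = 1 := by simpa [dl] using hz
        have hcz : c + z ≠ c := by
          intro h; rw [h] at hzd; simp [dl] at hzd
        have hczV : c + z ∈ V := hV _ (by omega)
        have hslp : σ (c + z) = .sleeping := by
          have a1 := d3 (c + z) (by omega) (by omega)
          have a2 := hst _ hczV hcz
          revert a1 a2
          cases σ (c + z) with
          | sleeping => simp
          | active n => simp [numActive]
        have harr : Arr V c (some z) (c + z) := ⟨z, rfl, hczV, rfl⟩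
        have hval : stepC V c (some z) σ (c + z) = .active 2 := by
          simp only [stepC, harr, if_true, hcz, if_false, hslp, addParticle]
        have hc0 : stepC V c (some z) σ c = .active 0 := by
          have : ¬ Arr V c (some z) c := by
            rintro ⟨z', h1, _, h2⟩; cases h1; exact hcz h2
          simp only [stepC, this, if_false, if_true, outSt, hc1, numActive]
        unfold Psi
        rw [if_pos hc0]
        apply Ps_le
        refine Or.inr ⟨c + z, D, ⟨by omega, by omega, d2, ?_, by rw [hval]; rfl⟩, ?_⟩
        · intro x hx1 hx2
          refine stepC_ne_zero _ _ _ _ _ (d3 x hx1 hx2) ?_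
          rintro rfl; simp [dl] at hx1
        · rw [hzd]; simp
      have j1 := mul_le_mul_of_nonneg_left (s3 e1 (by simp [e1])) (half_nonneg_of hJ)
      have j2 := mul_le_mul_of_nonneg_left (s3 (-e1) (by simp [e1])) (half_nonneg_of hJ)
      rw [s2]
      have : lamS lam * -(Hs c N σ / lam) = - (lamJ lam * Hs c N σ) := by
        unfold lamS lamJ; field_simp
      rw [this]
      linarith

theorem exists_strat {lam : ℝ} (hlam : 0 < lam) (V : Finset (Site 1)) (c : Site 1) (N : ℕ)
    (hV : ∀ x, dl c x ≤ N → x ∈ V) :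
    ∃ S : Strat 1 V, ∀ σ, ¬ Stable V σ →
      lamS lam * Psi lam V c N (stepC V (S.f σ) none σ)
      + lamJ lam / 2 * Psi lam V c N (stepC V (S.f σ) (some e1) σ)
      + lamJ lam / 2 * Psi lam V c N (stepC V (S.f σ) (some (-e1)) σ) ≤ Psi lam V c N σ := by
  have h : ∀ σ, ∃ x, ¬ Stable V σ → x ∈ V ∧ 1 ≤ numActive (σ x) ∧
      lamS lam * Psi lam V c N (stepC V x none σ)
      + lamJ lam / 2 * Psi lam V c N (stepC V x (some e1) σ)
      + lamJ lam / 2 * Psi lam V c N (stepC V x (some (-e1)) σ) ≤ Psi lam V c N σ := by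
    intro σ
    by_cases hns : Stable V σ
    · exact ⟨c, fun h => absurd hns h⟩
    · obtain ⟨x, hx⟩ := good_move hlam V c N hV σ hns
      exact ⟨x, fun _ => hx⟩
  choose f hf using h
  exact ⟨⟨f, fun σ hσ => (hf σ hσ).1, fun σ hσ => (hf σ hσ).2.1⟩, fun σ hσ => (hf σ hσ).2.2⟩

/-- The optional stopping bound. -/
theorem pr_bound {lam : ℝ} (hlam : 0 < lam) {V : Finset (Site 1)} {c : Site 1} {N : ℕ}
    (hV : ∀ x, dl c x ≤ N → x ∈ V) (S : Strat 1 V)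
    (hS : ∀ σ, ¬ Stable V σ →
      lamS lam * Psi lam V c N (stepC V (S.f σ) none σ)
      + lamJ lam / 2 * Psi lam V c N (stepC V (S.f σ) (some e1) σ)
      + lamJ lam / 2 * Psi lam V c N (stepC V (S.f σ) (some (-e1)) σ) ≤ Psi lam V c N σ) :
    ∀ n σ, pr lam S (fun σ => σ c = .active 0) n σ ≤ Psi lam V c N σ +
      (1 / lam) * (1 / (N + 1 : ℝ) * pr lam S (fun _ => True) n σ + ∑ i ∈ Finset.range N,
        (pr lam S (fun σ => σ (sh c (i + 1)) = .active 0) n σ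
          + pr lam S (fun σ => σ (sh c (-(i + 1))) = .active 0) n σ) / (i + 1 : ℝ)) := by
  have hcV : c ∈ V := hV c (by simp [dl])
  have stab : ∀ σ, Stable V σ →
      hole σ c ≤ Psi lam V c N σ + (1 / lam) * Hs c N σ := by
    intro σ hσ
    have hH := Hs_nonneg c N σ
    by_cases hc : σ c = .active 0
    · have : Ps c N σ = 1 := by
        rcases Ps_mem c N σ with h | ⟨y, D, hv, _⟩
        · exact h
        · obtain ⟨v1, v2, v3, v4, v5⟩ := hv
          have := hσ y (hV y (by omega)); omega
      simp only [hole, Psi, hc, if_true, this]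
      have : 0 ≤ 1 / lam * Hs c N σ := by positivity
      linarith
    · simp only [hole, Psi, hc, if_false, hσ, if_true]
      apply le_of_eq; ring
  intro n
  induction n with
  | zero =>
    intro σ
    by_cases hσ : Stable V σ
    · have := stab σ hσ
      simpa only [pr, hσ, true_and, hole, Hs, if_true, mul_one] using this
    · simp only [pr, hσ, false_and, if_false]
      have : 0 ≤ Psi lam V c N σ := by
        unfold Psi
        rw [if_neg hσ]
        split_ifs
        · exact Qs_nonneg _ _ _ _ (Ps_mem _ _ _)
        · exact le_rfl
      simpa using this
  | succ n ih =>
    intro σ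
    by_cases hσ : Stable V σ
    · have := stab σ hσ
      simp only [hole, Hs] at this
      simp only [pr, hσ, if_true, mul_one]
      convert this
    · have hS0 : 0 ≤ lamS lam := by unfold lamS; positivity
      have hJ : 0 ≤ lamJ lam := by unfold lamJ; positivity
      have i1 := mul_le_mul_of_nonneg_left (ih (stepC V (S.f σ) none σ)) hS0
      have i2 := mul_le_mul_of_nonneg_left (ih (stepC V (S.f σ) (some e1) σ)) (half_nonneg_of hJ)
      have i3 := mul_le_mul_of_nonneg_left (ih (stepC V (S.f σ) (some (-e1)) σ)) (half_nonneg_of hJ)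
      have i4 := hS σ hσ
      simp only [pr, hσ, if_false]
      have hsum : ∀ (A B C A' B' C' : ℕ → ℝ), ∑ i ∈ Finset.range N,
          (lamS lam * A i + lamJ lam / 2 * B i + lamJ lam / 2 * C i +
            (lamS lam * A' i + lamJ lam / 2 * B' i + lamJ lam / 2 * C' i)) / (i + 1 : ℝ) =
          lamS lam * ∑ i ∈ Finset.range N, (A i + A' i) / (i + 1 : ℝ)
          + lamJ lam / 2 * ∑ i ∈ Finset.range N, (B i + B' i) / (i + 1 : ℝ)
          + lamJ lam / 2 * ∑ i ∈ Finset.range N, (C i + C' i) / (i + 1 : ℝ) := by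
        intro A B C A' B' C'
        simp only [Finset.mul_sum, ← Finset.sum_add_distrib]
        refine Finset.sum_congr rfl fun i _ => ?_
        ring
      rw [hsum]
      linarith

/-- The key recursive inequality. -/
theorem key_ineq {lam : ℝ} (hlam : 0 < lam) {μ : Measure (Stacks 1)}
    (hμ : IsStackLaw 1 (ssrwStep 1) lam μ) (V : Finset (Site 1)) (c : Site 1) (N : ℕ)
    (hV : ∀ x, dl c x ≤ N → x ∈ V) (η : Site 1 → ℕ) (hη : 1 ≤ η c) :
    μ.real (Em V η c) ≤ (1 / lam) * (1 / (N + 1 : ℝ) + ∑ i ∈ Finset.range N,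
      (μ.real (Em V η (sh c (i + 1))) + μ.real (Em V η (sh c (-(i + 1))))) / (i + 1 : ℝ)) := by
  have hprob := hμ.1
  obtain ⟨S, hS⟩ := exists_strat hlam V c N hV
  have hE : ∀ P n, μ.real (Ev S P n (initState 1 V η)) = pr lam S P n (initState 1 V η).1 := by
    intro P n
    have := Ev_real hlam hμ S P n (initState 1 V η) ∅ (fun _ => none) (by simp)
    have h2 : Cyl ∅ (fun _ => none) = Set.univ := by simp [Cyl]
    rw [h2] at this
    simpa using this
  have hcV : c ∈ V := hV c (by simp [dl])
  have hPsi : Psi lam V c N (initState 1 V η).1 ≤ 0 := by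
    apply Psi_le_zero hlam
    simp only [initState, hcV, if_true, ne_eq, SiteState.active.injEq]
    omega
  have hn : ∀ n, μ.real (Ev S (fun σ => σ c = .active 0) n (initState 1 V η)) ≤
      (1 / lam) * (1 / (N + 1 : ℝ) + ∑ i ∈ Finset.range N,
      (μ.real (Em V η (sh c (i + 1))) + μ.real (Em V η (sh c (-(i + 1))))) / (i + 1 : ℝ)) := by
    intro n
    have hb := pr_bound hlam hV S hS n (initState 1 V η).1
    rw [← hE] at hb
    refine hb.trans ?_
    simp only [← hE]
    have : 1 / lam * (1 / (N + 1 : ℝ) * μ.real (Ev S (fun _ => True) n (initState 1 V η)) +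
        ∑ i ∈ Finset.range N,
        (μ.real (Ev S (fun σ => σ (sh c (i + 1)) = .active 0) n (initState 1 V η))
          + μ.real (Ev S (fun σ => σ (sh c (-(i + 1))) = .active 0) n (initState 1 V η)))
            / (i + 1 : ℝ)) ≤
        (1 / lam) * (1 / (N + 1 : ℝ) + ∑ i ∈ Finset.range N,
      (μ.real (Em V η (sh c (i + 1))) + μ.real (Em V η (sh c (-(i + 1))))) / (i + 1 : ℝ)) := by
      gcongr
      · exact mul_le_of_le_one_right (by positivity) measureReal_le_one
      all_goals first
        | exact Ev_sub_Em S η _ n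
        | exact measure_ne_top _ _
    linarith
  have hlim : Tendsto (fun n => μ.real (Ev S (fun σ => σ c = .active 0) n (initState 1 V η)))
      atTop (𝓝 (μ.real (Em V η c))) := by
    rw [Em_eq_iUnion S η c]
    exact (ENNReal.tendsto_toReal (measure_ne_top μ _)).comp
      (tendsto_measure_iUnion_atTop (Ev_mono S η c))
  exact le_of_tendsto' hlim hn

/-- Inductive bound. -/
theorem main_bound (k : ℕ) : ∃ C > (0 : ℝ), ∀ lam ≥ (3 : ℝ), ∀ μ : Measure (Stacks 1),
    IsStackLaw 1 (ssrwStep 1) lam μ → ∀ (V : Finset (Site 1)) (η : Site 1 → ℕ) (c : Site 1),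
    (∀ x, (dl c x : ℝ) ≤ ∑ j ∈ Finset.range (k + 1), lam ^ j → x ∈ V ∧ 1 ≤ η x) →
    μ.real (Em V η c) ≤ C * (Real.log lam ^ k / lam ^ (k + 1)) := by
  induction k with
  | zero =>
    refine ⟨1, one_pos, fun lam hlam μ hμ V η c h => ?_⟩
    have := key_ineq (by linarith) hμ V c 0 (fun x hx => (h x (by
      have : dl c x = 0 := by omega
      simp [this])).1) η (h c (by simp [dl])).2
    simpa using this
  | succ k ih =>
    obtain ⟨C, hC, ih⟩ := ih
    refine ⟨2 + 2 * (k + 2) * C, by positivity, fun lam hlam μ hμ V η c h => ?_⟩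
    have hl0 : (0 : ℝ) < lam := by linarith
    have hl1 : (1 : ℝ) ≤ lam := by linarith
    have hlog : 1 ≤ Real.log lam := by
      rw [Real.le_log_iff_exp_le hl0]
      exact (Real.exp_one_lt_d9.le.trans (by norm_num)).trans hlam
    set L := Real.log lam with hL
    set X := lam ^ (k + 1) with hX
    have hX1 : 1 ≤ X := one_le_pow₀ hl1
    have hX0 : 0 < X := by linarith
    set N := ⌊X⌋₊ with hN
    have hNX : (N : ℝ) ≤ X := Nat.floor_le hX0.le
    have hXN : X ≤ N + 1 := (Nat.lt_floor_add_one X).le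
    have hNpos : 1 ≤ N := Nat.le_floor (by simpa using hX1)
    have hr : ∑ j ∈ Finset.range (k + 1 + 1), lam ^ j =
        (∑ j ∈ Finset.range (k + 1), lam ^ j) + X := Finset.sum_range_succ _ _
    have hr0 : 0 ≤ ∑ j ∈ Finset.range (k + 1), lam ^ j :=
      Finset.sum_nonneg fun i _ => by positivity
    rw [hr] at h
    have hq : ∀ n : ℤ, n.natAbs ≤ N → μ.real (Em V η (sh c n)) ≤ C * (L ^ k / X) := by
      intro n hn
      refine ih lam hlam μ hμ V η _ fun x hx => h x ?_
      have h1 : dl c x ≤ dl (sh c n) x + n.natAbs := by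
        simp only [dl, sh]; omega
      have h2 : (dl c x : ℝ) ≤ dl (sh c n) x + n.natAbs := by exact_mod_cast h1
      have h3 : (n.natAbs : ℝ) ≤ N := by exact_mod_cast hn
      linarith
    have hkey := key_ineq hl0 hμ V c N (fun x hx => (h x (by
      have : (dl c x : ℝ) ≤ N := by exact_mod_cast hx
      linarith)).1) η (h c (by simp [dl]; linarith)).2
    refine hkey.trans ?_
    have hharm : ∑ i ∈ Finset.range N, (1 : ℝ) / (i + 1 : ℝ) ≤ (k + 2) * L := by
      have h1 := harmonic_le_one_add_log N
      have h2 : ((harmonic N : ℚ) : ℝ) = ∑ i ∈ Finset.range N, (1 : ℝ) / (i + 1 : ℝ) := by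
        simp [harmonic]
      have h3 : Real.log N ≤ (k + 1) * L := by
        have : Real.log N ≤ Real.log X :=
          Real.log_le_log (by exact_mod_cast hNpos) hNX
        rw [hX, Real.log_pow] at this
        push_cast at this; exact this
      rw [← h2]; linarith
    have hsum : ∑ i ∈ Finset.range N,
        (μ.real (Em V η (sh c (i + 1))) + μ.real (Em V η (sh c (-(i + 1))))) / (i + 1 : ℝ) ≤
        2 * (C * (L ^ k / X)) * ((k + 2) * L) := by
      refine le_trans ?_ (mul_le_mul_of_nonneg_left hharm (by positivity))
      rw [Finset.mul_sum]
      refine Finset.sum_le_sum fun i hi => ?_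
      have hi' := Finset.mem_range.mp hi
      have a1 := hq (i + 1) (by omega)
      have a2 := hq (-(i + 1)) (by omega)
      rw [mul_one_div]
      gcongr
      linarith
    have hfirst : 1 / (N + 1 : ℝ) ≤ 2 * (L ^ (k + 1) / X) := by
      have b1 : 1 / (N + 1 : ℝ) ≤ 1 / X := by gcongr
      have b2 : 1 / X ≤ L ^ (k + 1) / X := by
        gcongr; exact one_le_pow₀ hlog
      have b3 : 0 ≤ L ^ (k + 1) / X := by positivity
      linarith
    have hfin : 1 / lam * (2 * (L ^ (k + 1) / X) + 2 * (C * (L ^ k / X)) * ((k + 2) * L)) =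
        (2 + 2 * (k + 2) * C) * (L ^ (k + 1) / lam ^ (k + 1 + 1)) := by
      rw [hX]; field_simp; ring
    rw [← hfin]
    gcongr

end ARWProof


theorem arw_dim1_stab_empty_bound_iterated (k : ℕ) (hk : 1 ≤ k) :
    ∃ C > (0 : ℝ), ∃ lam₀ > (1 : ℝ), ∀ lam ≥ lam₀,
      ∀ V : Finset (Site 1), ball 1 (∑ j ∈ Finset.range (k + 1), lam ^ j) ⊆ ↑V →
        ∀ η : Site 1 → ℕ, Fills η (ball 1 (∑ j ∈ Finset.range (k + 1), lam ^ j)) →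
          stackLaw 1 (ssrwStep 1) lam {I | EmptyAt0 V I η} ≤
            ENNReal.ofReal (C * (Real.log lam ^ k / lam ^ (k + 1))) := by 
  obtain ⟨C, hC, hb⟩ := ARWProof.main_bound k
  refine ⟨C, hC, 3, by norm_num, fun lam hlam V hV η hη => ?_⟩
  unfold stackLaw
  split_ifs with h
  · have hμ := h.choose_spec
    have hprob := hμ.1
    have hd : ∀ x : Site 1, x ∈ ball 1 (∑ j ∈ Finset.range (k + 1), lam ^ j) ↔
        (ARWProof.dl 0 x : ℝ) ≤ ∑ j ∈ Finset.range (k + 1), lam ^ j := by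
      intro x; simp [ball, ARWProof.dl]
    have h1 := hb lam hlam _ hμ V η 0 (fun x hx =>
      ⟨by exact_mod_cast hV ((hd x).2 hx), hη x ((hd x).2 hx)⟩)
    have h0 : (0 : Site 1) ∈ V := by
      have : (0 : Site 1) ∈ ball 1 (∑ j ∈ Finset.range (k + 1), lam ^ j) := by
        rw [hd]
        simp only [ARWProof.dl, sub_self, Int.natAbs_zero, Nat.cast_zero]
        exact Finset.sum_nonneg fun i _ => pow_nonneg (by linarith) _
      exact_mod_cast hV this
    refine (measure_mono (ARWProof.emptyAt0_sub V η h0)).trans ?_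
    rw [← ENNReal.ofReal_toReal (measure_ne_top _ (ARWProof.Em V η 0))]
    exact ENNReal.ofReal_le_ofReal h1
  · simp
end

section
/- Consider activated random walk on ℤ with simple symmetric nearest-neighbor jumps. There exist a constant C > 0 and λ₀ > 1 such that for all λ ≥ λ₀, all finite V ⊂ ℤ with V ⊇ B_λ, and all all-active configurations η filling B_λ, the number of chances in the strong stabilization of η on V with respect to the origin satisfies P(Ch(η, V) = 1) ≤ C · λ^{−1} · log λ, where B_λ = {x ∈ ℤ : |x| ≤ λ}. -/
/-!
Common framework for the activated random walk (ARW) model on `ℤ^d`,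
via the site-wise (Diaconis–Fulton) representation.
-/

open MeasureTheory ENNReal Filter

open MeasureTheory ENNReal Filter Topology ARW


namespace ARW
section
open scoped Classical

/-- Toppling `x` with a given instruction `a`. -/
noncomputable def toppleA {d : ℕ} (V : Finset (Site d)) (a : Instr d) (x : Site d) (s : State d) :
    State d :=
  let σ := s.1
  let m := s.2
  let σ' : Config d :=
    match a with
    | none => if numActive (σ x) = 1 then Function.update σ x .sleeping else σ
    | some z =>
        let σ₁ := Function.update σ x (SiteState.active (numActive (σ x) - 1))
        if x + z ∈ V then Function.update σ₁ (x + z) (addParticle (σ₁ (x + z))) else σ₁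
  (σ', Function.update m x (m x + 1))

theorem topple_eq {d : ℕ} (V : Finset (Site d)) (I : Stacks d) (x : Site d) (s : State d) :
    topple V I x s = toppleA V (I (x, s.2 x)) x s := rfl

/-- Number of particles. -/
def cnt : SiteState → ℕ
  | .active n => n
  | .sleeping => 1

theorem numActive_active (n : ℕ) : numActive (.active n) = n := rfl

theorem cnt_active (n : ℕ) : cnt (.active n) = n := rfl

theorem numActive_le_cnt (a : SiteState) : numActive a ≤ cnt a := by
  cases a <;> simp [numActive, cnt]

theorem cnt_le_of_numActive (a : SiteState) (h : numActive a = 0) : cnt a ≤ 1 := by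
  cases a <;> simp_all [numActive, cnt]

theorem cnt_add (a : SiteState) : cnt (addParticle a) = cnt a + 1 := by
  cases a <;> simp [addParticle, cnt]

theorem numActive_add (a : SiteState) : numActive (addParticle a) = cnt a + 1 := by
  cases a <;> simp [addParticle, cnt, numActive]

theorem le_add (a : SiteState) : numActive a ≤ numActive (addParticle a) := by
  cases a <;> simp [addParticle, numActive]

theorem cnt_of_pos (a : SiteState) (h : 1 ≤ numActive a) : a = .active (numActive a) := by
  cases a <;> simp_all [numActive]

variable {d : ℕ} (V : Finset (Site d))

theorem toppleA_none_ge2 (x : Site d) (s : State d) (h : 2 ≤ numActive (s.1 x)) :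
    (toppleA V none x s).1 = s.1 := by
  have : numActive (s.1 x) ≠ 1 := by omega
  simp [toppleA, this]

theorem toppleA_snd (a : Instr d) (x : Site d) (s : State d) :
    (toppleA V a x s).2 = Function.update s.2 x (s.2 x + 1) := rfl

theorem numActive_mono (a : Instr d) (x y : Site d) (s : State d) (h : y ≠ x) :
    numActive (s.1 y) ≤ numActive ((toppleA V a x s).1 y) := by
  rcases a with _ | z
  · simp only [toppleA]
    split_ifs <;> simp [h]
  · simp only [toppleA]
    split_ifs
    · by_cases hz : y = x + z
      · subst hz
        simp [h, le_add]
      · simp [hz, h]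
    · simp [h]

theorem numActive_keep (a : Instr d) (x y : Site d) (s : State d) (h1 : 1 ≤ numActive (s.1 y))
    (h : y = x → 2 ≤ numActive (s.1 x)) :
    1 ≤ numActive ((toppleA V a x s).1 y) := by
  by_cases hy : y = x
  · subst hy
    have h2 := h rfl
    rcases a with _ | z
    · rw [toppleA_none_ge2 V y s h2]; exact h1
    · simp only [toppleA]
      split_ifs
      · by_cases hz : y = y + z
        · rw [← hz]
          simp [numActive_add]
        · simp only [Function.update_of_ne hz, Function.update_self, numActive_active]
          omega
      · simp only [Function.update_self, numActive_active]
        omega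
  · exact h1.trans (numActive_mono V a x y s hy)

theorem cnt_some (z x y : Site d) (s : State d) (h : 1 ≤ numActive (s.1 x)) (hy : y ∈ V) :
    cnt ((toppleA V (some z) x s).1 y) + (if y = x then 1 else 0) =
      cnt (s.1 y) + (if y = x + z then 1 else 0) := by
  have hx := cnt_of_pos _ h
  generalize numActive (s.1 x) = n at hx h
  have hc : cnt (s.1 x) = n := by rw [hx]; rfl
  have hn : numActive (s.1 x) = n := by rw [hx]; rfl
  simp only [toppleA, hn]
  by_cases h1 : y = x + z
  · have hm : x + z ∈ V := h1 ▸ hy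
    rw [if_pos hm, h1, Function.update_self, cnt_add]
    by_cases h2 : x + z = x
    · rw [h2, Function.update_self, cnt_active, hc]
      simp only [if_true]
      omega
    · simp [h2]
  · by_cases h2 : y = x
    · subst h2
      rw [if_pos rfl, if_neg h1, hc]
      split_ifs
      · rw [Function.update_of_ne h1, Function.update_self, cnt_active]
        omega
      · rw [Function.update_self, cnt_active]
        omega
    · rw [if_neg h2, if_neg h1]
      split_ifs
      · rw [Function.update_of_ne h1, Function.update_of_ne h2]
      · rw [Function.update_of_ne h2]

theorem cnt_none (x y : Site d) (s : State d) :
    cnt ((toppleA V none x s).1 y) = cnt (s.1 y) := by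
  simp only [toppleA]
  split_ifs with h
  · by_cases h2 : y = x
    · subst h2
      have := cnt_of_pos _ (by omega : 1 ≤ numActive (s.1 y))
      rw [this, h]
      simp [cnt]
    · simp [h2]
  · rfl

/-- commutation -/
theorem toppleA_comm (a b : Instr d) (x y : Site d) (s : State d) (hxy : x ≠ y)
    (hx : 1 ≤ numActive (s.1 x)) (hy : 1 ≤ numActive (s.1 y)) :
    toppleA V a x (toppleA V b y s) = toppleA V b y (toppleA V a x s) := by
  obtain ⟨σ, m⟩ := s
  simp only at hx hy
  obtain ⟨p, hp⟩ : ∃ p, σ x = .active (p + 1) := by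
    refine ⟨numActive (σ x) - 1, ?_⟩
    rw [Nat.sub_add_cancel hx]; exact cnt_of_pos _ hx
  obtain ⟨q, hq⟩ : ∃ q, σ y = .active (q + 1) := by
    refine ⟨numActive (σ y) - 1, ?_⟩
    rw [Nat.sub_add_cancel hy]; exact cnt_of_pos _ hy
  have hyx := hxy.symm
  refine Prod.ext ?_ ?_
  swap
  · simp only [toppleA]
    rw [Function.update_of_ne hxy, Function.update_of_ne hyx, Function.update_comm hxy]
  · funext w
    rcases a with _ | z <;> rcases b with _ | z' <;>
    · simp only [toppleA]
      by_cases h1 : w = x <;> by_cases h2 : w = y <;>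
      grind [numActive, addParticle, Function.update_apply]

end
end ARW

namespace ARW
section
open scoped Classical

/-- Toppling threshold. -/
noncomputable def thr {d : ℕ} (S : Set (Site d)) (x : Site d) : ℕ := if x ∈ S then 2 else 1

theorem one_le_thr {d : ℕ} (S : Set (Site d)) (x : Site d) : 1 ≤ thr S x := by
  unfold thr; split_ifs <;> omega

/-- Normal form for the toppling procedure with thresholds. -/
def Nf {d : ℕ} (V : Finset (Site d)) (S : Set (Site d)) (s : State d) : Prop :=
  ∀ x ∈ V, numActive (s.1 x) < thr S x

/-- `RT n s u`: `u` is a normal form reached from `s` in exactly `n` legal topplings. -/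
inductive RT {d : ℕ} (V : Finset (Site d)) (I : Stacks d) (S : Set (Site d)) :
    ℕ → State d → State d → Prop
  | zero (s : State d) : Nf V S s → RT V I S 0 s s
  | succ (n : ℕ) (s u : State d) (x : Site d) : x ∈ V → thr S x ≤ numActive (s.1 x) →
      RT V I S n (topple V I x s) u → RT V I S (n + 1) s u

variable {d : ℕ} {V : Finset (Site d)} {I : Stacks d} {S : Set (Site d)}

theorem topple_comm (x y : Site d) (s : State d) (hxy : x ≠ y)
    (hx : 1 ≤ numActive (s.1 x)) (hy : 1 ≤ numActive (s.1 y)) :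
    topple V I x (topple V I y s) = topple V I y (topple V I x s) := by
  have h1 : (topple V I y s).2 x = s.2 x := by simp [topple_eq, toppleA_snd, hxy]
  have h2 : (topple V I x s).2 y = s.2 y := by simp [topple_eq, toppleA_snd, hxy.symm]
  rw [topple_eq V I x (topple V I y s), topple_eq V I y (topple V I x s), h1, h2,
    topple_eq, topple_eq, toppleA_comm V _ _ x y s hxy hx hy]

theorem RT.strip {n : ℕ} {s u : State d} (h : RT V I S n s u) (x : Site d) (hx : x ∈ V)
    (hl : thr S x ≤ numActive (s.1 x)) :
    ∃ m, n = m + 1 ∧ RT V I S m (topple V I x s) u := by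
  induction h with
  | zero s hs => exact absurd hl (not_le.mpr (hs x hx))
  | succ n s u y hy hly hr ih =>
    refine ⟨n, rfl, ?_⟩
    by_cases hxy : x = y
    · subst hxy; exact hr
    · have hl' : thr S x ≤ numActive ((topple V I y s).1 x) :=
        hl.trans (numActive_mono V _ y x s hxy)
      obtain ⟨m, rfl, hm⟩ := ih hl'
      refine RT.succ m _ _ y hy (hly.trans (numActive_mono V _ x y s (Ne.symm hxy))) ?_
      rw [topple_comm y x s (Ne.symm hxy) ((one_le_thr S y).trans hly) ((one_le_thr S x).trans hl)]
      exact hm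

theorem RT.nf {n : ℕ} {s u : State d} (h : RT V I S n s u) : Nf V S u := by
  induction h with
  | zero s hs => exact hs
  | succ n s u y hy hly hr ih => exact ih

theorem RT.eq_of_nf {n : ℕ} {s u : State d} (h : RT V I S n s u) (hs : Nf V S s) : n = 0 ∧ u = s := by
  cases h with
  | zero => exact ⟨rfl, rfl⟩
  | succ n _ _ y hy hly hr => exact absurd hly (not_le.mpr (hs y hy))

theorem RT.unique {n m : ℕ} {s u v : State d} (h : RT V I S n s u) (h' : RT V I S m s v) :
    u = v := by
  induction h generalizing m with
  | zero s hs => exact (h'.eq_of_nf hs).2.symm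
  | succ n s u y hy hly hr ih =>
    obtain ⟨k, -, hk⟩ := h'.strip y hy hly
    exact ih hk

theorem RT.keep {n : ℕ} {s u : State d} (h : RT V I S n s u) (y : Site d) (hy : y ∈ S)
    (h1 : 1 ≤ numActive (s.1 y)) : 1 ≤ numActive (u.1 y) := by
  induction h with
  | zero s hs => exact h1
  | succ n s u x hx hl hr ih =>
    refine ih (numActive_keep V _ x y s h1 ?_)
    rintro rfl
    simpa [thr, hy] using hl

theorem not_nf {s : State d} (h : ¬ Nf V S s) : ∃ x ∈ V, thr S x ≤ numActive (s.1 x) := by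
  simpa [Nf] using h

theorem nf_iff (h0 : 0 ∈ V) (s : State d) : Nf V {0} s ↔ WStable V s.1 := by
  unfold Nf WStable thr
  constructor
  · intro h
    refine ⟨by have := h 0 h0; simp at this; omega, fun x hx hx0 => ?_⟩
    have := h x hx
    simpa [hx0] using this
  · rintro ⟨h1, h2⟩ x hx
    by_cases hx0 : x = 0
    · subst hx0; simp; omega
    · simp [hx0, h2 x hx hx0]

theorem rt_of_list (h0 : 0 ∈ V) (l : List (Site d)) : ∀ s : State d, WLegal V I s l →
    WStable V (run V I s l).1 → RT V I {0} l.length s (run V I s l) := by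
  induction l with
  | nil => intro s _ h; exact RT.zero s ((nf_iff h0 s).2 h)
  | cons x l ih =>
    rintro s ⟨h1, h2, h3⟩ h
    exact RT.succ _ _ _ x h1 (by simpa [thr] using h2) (ih _ h3 h)

theorem list_of_rt (h0 : 0 ∈ V) {n : ℕ} {s u : State d} (h : RT V I {0} n s u) :
    ∃ l, WLegal V I s l ∧ WStable V (run V I s l).1 := by
  induction h with
  | zero s hs => exact ⟨[], trivial, (nf_iff h0 s).1 hs⟩
  | succ n s u x hx hl hr ih =>
    obtain ⟨l, h1, h2⟩ := ih
    exact ⟨x :: l, ⟨hx, by simpa [thr] using hl, h1⟩, h2⟩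

theorem weakStab_eq (h0 : 0 ∈ V) {n : ℕ} {s u : State d} (h : RT V I {0} n s u) :
    weakStab V I s = u := by
  have hex := list_of_rt h0 h
  unfold weakStab
  rw [dif_pos hex]
  exact (rt_of_list h0 _ s hex.choose_spec.1 hex.choose_spec.2).unique h

/-- Skipping one (sleep) instruction at the origin. -/
def bump {d : ℕ} (s : State d) : State d := (s.1, Function.update s.2 0 (s.2 0 + 1))

theorem jumpOut_spec (s : State d) (k : ℕ) (z : Site d) (h : I (0, s.2 0 + k) = some z)
    (hk : ∀ j < k, I (0, s.2 0 + j) = none) :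
    jumpOut V I s = ((if (0 : Site d) + z ∈ V then
        Function.update (Function.update s.1 0 (SiteState.active (numActive (s.1 0) - 1)))
          ((0 : Site d) + z)
          (addParticle (Function.update s.1 0 (SiteState.active (numActive (s.1 0) - 1))
            ((0 : Site d) + z)))
      else Function.update s.1 0 (SiteState.active (numActive (s.1 0) - 1))),
      Function.update s.2 0 (s.2 0 + k + 1)) := by
  have hex : ∃ k, (I (0, s.2 0 + k)).isSome := ⟨k, by simp [h]⟩
  have hf : Nat.find hex = k := by
    rw [Nat.find_eq_iff]
    exact ⟨by simp [h], fun j hj => by simp [hk j hj]⟩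
  have hz : (I (0, s.2 0 + Nat.find hex)).get (Nat.find_spec hex) = z := by
    simp [hf, h]
  unfold jumpOut
  rw [dif_pos hex]
  simp only [hz]
  rw [hf]

theorem jumpOut_some (s : State d) (z : Site d) (h : I (0, s.2 0) = some z) :
    jumpOut V I s = topple V I 0 s := by
  rw [jumpOut_spec s 0 z h (by simp)]
  unfold topple
  simp only [h]

theorem jumpOut_none (s : State d) (h : I (0, s.2 0) = none)
    (hex : ∃ k, I (0, s.2 0 + k) ≠ none) :
    jumpOut V I s = jumpOut V I (bump s) := by
  have hb : (bump s).2 0 = s.2 0 + 1 := by simp [bump]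
  have hmin : ∀ j < Nat.find hex, I (0, s.2 0 + j) = none := fun j hj => by
    simpa using Nat.find_min hex hj
  obtain ⟨z, hz⟩ := Option.ne_none_iff_exists'.1 (Nat.find_spec hex)
  generalize Nat.find hex = k at hmin hz
  rcases k with _ | k
  · simp [h] at hz
  rw [jumpOut_spec s (k + 1) z hz hmin, jumpOut_spec (bump s) k z]
  · simp [bump]
    congr 1
    ring
  · rw [hb, show s.2 0 + 1 + k = s.2 0 + (k + 1) by ring]; exact hz
  · intro j hj
    rw [hb, show s.2 0 + 1 + j = s.2 0 + (j + 1) by ring]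
    exact hmin _ (by omega)

/-- The bad event following the first weak stabilization. -/
def JBad (V : Finset (Site d)) (I : Stacks d) (s : State d) : Prop :=
  (∀ k, I (0, s.2 0 + k) = none) ∨ ∀ n v, RT V I {0} n (jumpOut V I s) v → numActive (v.1 0) = 0

theorem chances_one (h0 : 0 ∈ V) (η : Site d → ℕ) (h : chances V I η = 1) :
    (¬ ∃ n u, RT V I {0} n (initState d V η) u) ∨
      ∃ n u, RT V I {0} n (initState d V η) u ∧ JBad V I u := by
  by_cases hN : ∃ n u, RT V I {0} n (initState d V η) u
  swap
  · exact Or.inl hN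
  right
  obtain ⟨n, u, hu⟩ := hN
  refine ⟨n, u, hu, Or.inr ?_⟩
  intro m v hv
  unfold chances at h
  split_ifs at h with hex
  · have hf : Nat.find hex = 1 := by exact_mod_cast h
    have h1 := Nat.find_spec hex
    have h2 := Nat.find_min hex (m := 0) (by omega)
    rw [hf] at h1
    have e0 : procState V I η 0 = u := weakStab_eq h0 hu
    rw [e0] at h2
    have e1 : procState V I η 1 = v := by
      show (if 1 ≤ numActive ((procState V I η 0).1 0) then
        weakStab V I (jumpOut V I (procState V I η 0)) else procState V I η 0) = v
      rw [e0, if_pos (Nat.one_le_iff_ne_zero.2 h2)]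
      exact weakStab_eq h0 hv
    rwa [e1] at h1
  · exact absurd h (by simp)

end
end ARW

namespace ARW
section
open scoped Classical

/-- unit steps -/
def ep : Site 1 := fun _ => 1
/-- unit steps -/
def em : Site 1 := fun _ => -1

theorem ep_ne_em : ep ≠ em := fun h => by
  have := congrFun h 0
  simp [ep, em] at this

/-- Cylinder event below the odometer `m`. -/
def CylE (m : Site 1 → ℕ) (E : Set (Stacks 1)) : Prop :=
  ∃ (F : Finset (Site 1 × ℕ)) (g : Site 1 × ℕ → Instr 1),
    E = {I | ∀ i ∈ F, I i = g i} ∧ ∀ i ∈ F, i.2 < m i.1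

theorem lamS_eq {lam : ℝ} (h : 0 < lam) : lamS lam = 1 - lamJ lam := by
  unfold lamS lamJ
  field_simp
  ring

theorem lamJ_pos {lam : ℝ} (h : 0 < lam) : 0 < lamJ lam := by
  unfold lamJ; positivity

theorem lamS_pos {lam : ℝ} (h : 0 < lam) : 0 < lamS lam := by
  unfold lamS; positivity

variable {lam : ℝ} {μ : Measure (Stacks 1)}

theorem weight_none (h : 0 < lam) : (instrWeight (ssrwStep 1) lam none).toReal = lamS lam := by
  simp [instrWeight, ENNReal.toReal_ofReal (lamS_pos h).le]

theorem weight_ep (h : 0 < lam) :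
    (instrWeight (ssrwStep 1) lam (some ep)).toReal = lamJ lam / 2 := by
  simp [instrWeight, ENNReal.toReal_ofReal (lamJ_pos h).le, ssrwStep, ep]
  ring

theorem weight_em (h : 0 < lam) :
    (instrWeight (ssrwStep 1) lam (some em)).toReal = lamJ lam / 2 := by
  simp [instrWeight, ENNReal.toReal_ofReal (lamJ_pos h).le, ssrwStep, em]
  ring

theorem meas_coord (i : Site 1 × ℕ) (a : Instr 1) : MeasurableSet {I : Stacks 1 | I i = a} := by
  have h : Measurable (fun I : Stacks 1 => I i) := measurable_pi_apply i
  have ha : MeasurableSet ({a} : Set (Instr 1)) := MeasurableSpace.measurableSet_top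
  exact h ha

theorem cyl_coord (hμ : IsStackLaw 1 (ssrwStep 1) lam μ) (i : Site 1 × ℕ) (a : Instr 1) :
    μ.real {I : Stacks 1 | I i = a} = (instrWeight (ssrwStep 1) lam a).toReal := by
  have := hμ.2 {i} (fun _ => a)
  simp only [Finset.mem_singleton, forall_eq, Finset.prod_singleton] at this
  rw [Measure.real, this]

theorem split (hμ : IsStackLaw 1 (ssrwStep 1) lam μ) (h : 0 < lam) (m : Site 1 → ℕ)
    (E : Set (Stacks 1)) (hE : CylE m E) (x : Site 1) :
    ∃ E₀ E₁ E₂ : Set (Stacks 1),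
      CylE (Function.update m x (m x + 1)) E₀ ∧ CylE (Function.update m x (m x + 1)) E₁ ∧
      CylE (Function.update m x (m x + 1)) E₂ ∧
      (∀ I ∈ E₀, I (x, m x) = none) ∧ (∀ I ∈ E₁, I (x, m x) = some ep) ∧
      (∀ I ∈ E₂, I (x, m x) = some em) ∧
      μ.real E₀ = lamS lam * μ.real E ∧ μ.real E₁ = lamJ lam / 2 * μ.real E ∧
      μ.real E₂ = lamJ lam / 2 * μ.real E ∧
      ∀ B, μ.real (E ∩ B) = μ.real (E₀ ∩ B) + μ.real (E₁ ∩ B) + μ.real (E₂ ∩ B) := by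
  have := hμ.1
  obtain ⟨F, g, rfl, hF⟩ := hE
  set i : Site 1 × ℕ := (x, m x) with hi
  have hiF : i ∉ F := fun hh => by simpa [hi] using hF i hh
  set E : Set (Stacks 1) := {I | ∀ i ∈ F, I i = g i} with hE
  have key : ∀ a : Instr 1, E ∩ {I | I i = a} =
      {I | ∀ j ∈ insert i F, I j = Function.update g i a j} := by
    intro a
    ext I
    simp only [hE, Set.mem_inter_iff, Set.mem_ofPred_eq, Finset.mem_insert, forall_eq_or_imp,
      Function.update_self]
    rw [and_comm]
    refine and_congr_right fun _ => forall₂_congr fun j hj => ?_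
    rw [Function.update_of_ne (show j ≠ i by rintro rfl; exact hiF hj)]
  have hcyl : ∀ a : Instr 1, CylE (Function.update m x (m x + 1)) (E ∩ {I | I i = a}) := by
    intro a
    refine ⟨insert i F, Function.update g i a, key a, ?_⟩
    intro j hj
    rcases Finset.mem_insert.1 hj with rfl | hj
    · simp [hi]
    · have := hF j hj
      by_cases hx : j.1 = x
      · rw [hx, Function.update_self, ← hx]; omega
      · rw [Function.update_of_ne hx]; exact this
  have hmu : ∀ a : Instr 1, μ.real (E ∩ {I | I i = a}) =
      (instrWeight (ssrwStep 1) lam a).toReal * μ.real E := by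
    intro a
    rw [key, Measure.real, Measure.real, hμ.2, hE, hμ.2, Finset.prod_insert hiF,
      ENNReal.toReal_mul, Function.update_self]
    congr 2
    refine Finset.prod_congr rfl fun j hj => ?_
    rw [Function.update_of_ne (show j ≠ i by rintro rfl; exact hiF hj)]
  have h01 : Disjoint {I : Stacks 1 | I i = none} {I : Stacks 1 | I i = some ep} :=
    Set.disjoint_left.2 fun I h1 h2 => by simp_all
  have h2 : Disjoint ({I : Stacks 1 | I i = none} ∪ {I : Stacks 1 | I i = some ep})
      {I : Stacks 1 | I i = some em} :=
    Set.disjoint_left.2 fun I h1 h2 => by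
      rcases h1 with h1 | h1
      · simp_all
      · simp only [Set.mem_ofPred_eq] at h1 h2
        rw [h1] at h2
        exact ep_ne_em (Option.some_injective _ h2)
  set U : Set (Stacks 1) := ({I : Stacks 1 | I i = none} ∪ {I : Stacks 1 | I i = some ep}) ∪
      {I : Stacks 1 | I i = some em} with hU
  have hUm : MeasurableSet U :=
    ((meas_coord i _).union (meas_coord i _)).union (meas_coord i _)
  have hU1 : μ.real U = 1 := by
    rw [hU, measureReal_union h2 (meas_coord i _), measureReal_union h01 (meas_coord i _),
      cyl_coord hμ, cyl_coord hμ, cyl_coord hμ, weight_none h, weight_ep h, weight_em h, lamS_eq h]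
    ring
  have hUc : μ.real Uᶜ = 0 := by
    rw [probReal_compl_eq_one_sub hUm, hU1, sub_self]
  refine ⟨E ∩ {I | I i = none}, E ∩ {I | I i = some ep}, E ∩ {I | I i = some em},
    hcyl _, hcyl _, hcyl _, fun I hI => hI.2, fun I hI => hI.2, fun I hI => hI.2, ?_, ?_, ?_, ?_⟩
  · rw [hmu, weight_none h]
  · rw [hmu, weight_ep h]
  · rw [hmu, weight_em h]
  · intro B
    have e1 := measureReal_inter_add_sdiff (μ := μ) (s := E ∩ B) hUm
    have e2 : μ.real ((E ∩ B) \ U) = 0 :=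
      measureReal_mono_null (fun I hI => hI.2) hUc
    have e3 := measureReal_inter_add_sdiff (μ := μ) (s := (E ∩ B) ∩ U) (meas_coord i none)
    have e4 := measureReal_inter_add_sdiff (μ := μ) (s := ((E ∩ B) ∩ U) \ {I | I i = none})
      (meas_coord i (some ep))
    have s1 : ((E ∩ B) ∩ U) ∩ {I | I i = none} = (E ∩ {I | I i = none}) ∩ B := by
      ext I; simp [hU]; tauto
    have s2 : (((E ∩ B) ∩ U) \ {I | I i = none}) ∩ {I | I i = some ep} =
        (E ∩ {I | I i = some ep}) ∩ B := by
      ext I; simp only [hU, Set.mem_inter_iff, Set.mem_sdiff, Set.mem_union, Set.mem_ofPred_eq]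
      constructor
      · tauto
      · rintro ⟨⟨a, b⟩, c⟩
        simp [a, b, c]
    have s3 : (((E ∩ B) ∩ U) \ {I | I i = none}) \ {I | I i = some ep} =
        (E ∩ {I | I i = some em}) ∩ B := by
      ext I; simp only [hU, Set.mem_inter_iff, Set.mem_sdiff, Set.mem_union, Set.mem_ofPred_eq]
      constructor
      · tauto
      · rintro ⟨⟨a, b⟩, c⟩
        simp [a, b, c, ep_ne_em.symm]
    rw [s1] at e3
    rw [s2, s3] at e4
    linarith

/-- Finishing within `L` steps in a state with property `P`. -/
def FinS (V : Finset (Site 1)) (P : Stacks 1 → State 1 → Prop) (L : ℕ) (s : State 1) :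
    Set (Stacks 1) :=
  {I | ∃ n ≤ L, ∃ u, RT V I {0} n s u ∧ P I u}

theorem finS_succ {V : Finset (Site 1)} {P : Stacks 1 → State 1 → Prop} {L : ℕ} {s : State 1}
    {x : Site 1} (hx : x ∈ V) (hl : thr {0} x ≤ numActive (s.1 x)) {I : Stacks 1} {a : Instr 1}
    (ha : I (x, s.2 x) = a) (h : I ∈ FinS V P (L + 1) s) : I ∈ FinS V P L (toppleA V a x s) := by
  obtain ⟨n, hn, u, hu, hP⟩ := h
  obtain ⟨m, rfl, hm⟩ := hu.strip x hx hl
  rw [topple_eq, ha] at hm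
  exact ⟨m, by omega, u, hm, hP⟩

theorem finS_pred {V : Finset (Site 1)} {P : Stacks 1 → State 1 → Prop} {L : ℕ} {s : State 1}
    {x : Site 1} (hx : x ∈ V) (hl : thr {0} x ≤ numActive (s.1 x)) {I : Stacks 1} {a : Instr 1}
    (ha : I (x, s.2 x) = a) (h : I ∈ FinS V P L (toppleA V a x s)) : I ∈ FinS V P (L + 1) s := by
  obtain ⟨n, hn, u, hu, hP⟩ := h
  rw [← ha, ← topple_eq] at hu
  exact ⟨n + 1, by omega, u, RT.succ n s u x hx hl hu, hP⟩

theorem finS_zero {V : Finset (Site 1)} {P : Stacks 1 → State 1 → Prop} {s : State 1}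
    (hs : ¬ Nf V {0} s) : FinS V P 0 s = ∅ := by
  ext I
  simp only [FinS, Set.mem_ofPred_eq, Set.mem_empty_iff_false, iff_false]
  rintro ⟨n, hn, u, hu, -⟩
  obtain rfl : n = 0 := by omega
  cases hu with
  | zero _ h => exact hs h

theorem finS_mono {V : Finset (Site 1)} {P : Stacks 1 → State 1 → Prop} (s : State 1) :
    Monotone (fun L => FinS V P L s) := by
  rintro L L' hL I ⟨n, hn, h⟩
  exact ⟨n, hn.trans hL, h⟩

theorem finS_limit [IsProbabilityMeasure μ] {V : Finset (Site 1)}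
    {P : Stacks 1 → State 1 → Prop} (s : State 1)
    (E : Set (Stacks 1)) (c : ℝ) (h : ∀ L, μ.real (E ∩ FinS V P L s) ≤ c) :
    μ.real (E ∩ {I | ∃ n u, RT V I {0} n s u ∧ P I u}) ≤ c := by
  have hc : 0 ≤ c := measureReal_nonneg.trans (h 0)
  have e : E ∩ {I | ∃ n u, RT V I {0} n s u ∧ P I u} = ⋃ L, E ∩ FinS V P L s := by
    rw [← Set.inter_iUnion]
    congr 1
    ext I
    simp only [FinS, Set.mem_ofPred_eq, Set.mem_iUnion]
    constructor
    · rintro ⟨n, u, hu⟩; exact ⟨n, n, le_rfl, u, hu⟩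
    · rintro ⟨L, n, -, u, hu⟩; exact ⟨n, u, hu⟩
  have hm : Monotone (fun L => E ∩ FinS V P L s) := fun L L' hL =>
    Set.inter_subset_inter_right _ (finS_mono s hL)
  rw [e, Measure.real, hm.measure_iUnion]
  refine ENNReal.toReal_le_of_le_ofReal hc (iSup_le fun L => ?_)
  rw [← ENNReal.ofReal_toReal (measure_ne_top μ (E ∩ FinS V P L s))]
  exact ENNReal.ofReal_le_ofReal (h L)

theorem mono_inter [IsProbabilityMeasure μ] {E B B' : Set (Stacks 1)}
    (h : ∀ I ∈ E, I ∈ B → I ∈ B') : μ.real (E ∩ B) ≤ μ.real (E ∩ B') :=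
  measureReal_mono fun I hI => ⟨hI.1, h I hI.1 hI.2⟩

theorem mono_left [IsProbabilityMeasure μ] {E B : Set (Stacks 1)} :
    μ.real (E ∩ B) ≤ μ.real E :=
  measureReal_mono Set.inter_subset_left

/-! ### Termination -/

/-- Potential. -/
noncomputable def hpot (M : ℝ) (y : Site 1) : ℝ := M ^ 2 - (y 0 : ℝ) ^ 2

/-- Potential. -/
noncomputable def Phi (V : Finset (Site 1)) (M : ℝ) (s : State 1) : ℝ :=
  ∑ y ∈ V, (cnt (s.1 y) : ℝ) * hpot M y

theorem hpot_nonneg {M : ℝ} {y : Site 1} (h : |(y 0 : ℝ)| ≤ M) : 0 ≤ hpot M y := by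
  have := sq_le_sq' (by linarith [abs_nonneg (y 0 : ℝ), neg_abs_le (y 0 : ℝ)] : -M ≤ (y 0 : ℝ))
    (by linarith [le_abs_self (y 0 : ℝ)])
  unfold hpot; linarith

theorem Phi_nonneg {V : Finset (Site 1)} {M : ℝ} (hM : ∀ y ∈ V, |(y 0 : ℝ)| + 1 ≤ M)
    (s : State 1) : 0 ≤ Phi V M s :=
  Finset.sum_nonneg fun y hy => mul_nonneg (by positivity) (hpot_nonneg (by linarith [hM y hy]))

theorem Phi_none (V : Finset (Site 1)) (M : ℝ) (s : State 1) (x : Site 1) :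
    Phi V M (toppleA V none x s) = Phi V M s := by
  unfold Phi
  simp only [cnt_none]

theorem Phi_some {V : Finset (Site 1)} {M : ℝ} (s : State 1) (x z : Site 1)
    (hx : x ∈ V) (hl : 1 ≤ numActive (s.1 x)) (hz : 0 ≤ hpot M (x + z)) :
    Phi V M (toppleA V (some z) x s) ≤ Phi V M s - hpot M x + hpot M (x + z) := by
  have key : ∀ y ∈ V, (cnt ((toppleA V (some z) x s).1 y) : ℝ) * hpot M y =
      (cnt (s.1 y) : ℝ) * hpot M y - (if y = x then hpot M y else 0) +
        (if y = x + z then hpot M y else 0) := by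
    intro y hy
    have e := cnt_some V z x y s hl hy
    have e' : (cnt ((toppleA V (some z) x s).1 y) : ℝ) + (if y = x then 1 else 0) =
      cnt (s.1 y) + (if y = x + z then 1 else 0) := by exact_mod_cast e
    have : (cnt ((toppleA V (some z) x s).1 y) : ℝ) =
      cnt (s.1 y) + (if y = x + z then 1 else 0) - (if y = x then 1 else 0) := by linarith
    rw [this]
    split_ifs <;> ring
  unfold Phi
  rw [Finset.sum_congr rfl key, Finset.sum_add_distrib, Finset.sum_sub_distrib,
    Finset.sum_ite_eq', Finset.sum_ite_eq', if_pos hx]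
  split_ifs <;> linarith

theorem nt_bound (hμ : IsStackLaw 1 (ssrwStep 1) lam μ) (h : 0 < lam) {V : Finset (Site 1)}
    {M : ℝ} (hM : ∀ y ∈ V, |(y 0 : ℝ)| + 1 ≤ M) (L : ℕ) :
    ∀ (s : State 1) (E : Set (Stacks 1)), CylE s.2 E →
      L * lamJ lam * μ.real (E ∩ (FinS V (fun _ _ => True) L s)ᶜ) ≤ μ.real E * Phi V M s := by
  have := hμ.1
  induction L with
  | zero =>
    intro s E hE
    simp only [Nat.cast_zero, zero_mul]
    exact mul_nonneg measureReal_nonneg (Phi_nonneg hM s)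
  | succ L ih =>
    intro s E hE
    by_cases hs : Nf V {0} s
    · have : (FinS V (fun _ _ => True) (L + 1) s)ᶜ = ∅ := by
        rw [Set.compl_empty_iff, Set.eq_univ_iff_forall]
        exact fun I => ⟨0, by omega, s, RT.zero s hs, trivial⟩
      rw [this]
      simp only [Set.inter_empty, measureReal_empty, mul_zero]
      exact mul_nonneg measureReal_nonneg (Phi_nonneg hM s)
    · obtain ⟨x, hx, hl⟩ := not_nf hs
      have hl1 := (one_le_thr _ x).trans hl
      obtain ⟨E₀, E₁, E₂, c0, c1, c2, i0, i1, i2, m0, m1, m2, hsum⟩ := split hμ h s.2 E hE x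
      rw [hsum]
      have b : ∀ (a : Instr 1) (E' : Set (Stacks 1)), (∀ I ∈ E', I (x, s.2 x) = a) →
          μ.real (E' ∩ (FinS V (fun _ _ => True) (L + 1) s)ᶜ) ≤
          μ.real (E' ∩ (FinS V (fun _ _ => True) L (toppleA V a x s))ᶜ) := fun a E' hi =>
        mono_inter fun I hI hB hB' => hB (finS_pred hx hl (hi I hI) hB')
      have a0 := ih (toppleA V none x s) E₀ c0
      have a1 := ih (toppleA V (some ep) x s) E₁ c1
      have a2 := ih (toppleA V (some em) x s) E₂ c2
      have b0 := b none E₀ i0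
      have b1 := b _ E₁ i1
      have b2 := b _ E₂ i2
      have t0 : μ.real (E₀ ∩ (FinS V (fun _ _ => True) (L + 1) s)ᶜ) ≤ μ.real E₀ := mono_left
      have t1 : μ.real (E₁ ∩ (FinS V (fun _ _ => True) (L + 1) s)ᶜ) ≤ μ.real E₁ := mono_left
      have t2 : μ.real (E₂ ∩ (FinS V (fun _ _ => True) (L + 1) s)ᶜ) ≤ μ.real E₂ := mono_left
      have hxM := hM x hx
      have p1 : Phi V M (toppleA V (some ep) x s) ≤ Phi V M s - hpot M x + hpot M (x + ep) :=
        Phi_some s x ep hx hl1 (hpot_nonneg (by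
          simp only [ep, Pi.add_apply]; push_cast
          exact (abs_add_le _ _).trans (by simpa using hxM)))
      have p2 : Phi V M (toppleA V (some em) x s) ≤ Phi V M s - hpot M x + hpot M (x + em) :=
        Phi_some s x em hx hl1 (hpot_nonneg (by
          simp only [em, Pi.add_apply]; push_cast
          exact (abs_add_le _ _).trans (by simpa using hxM)))
      have hh : hpot M (x + ep) + hpot M (x + em) = 2 * hpot M x - 2 := by
        simp only [hpot, ep, em, Pi.add_apply]; push_cast; ring
      rw [Phi_none] at a0
      have hq := lamJ_pos h
      have hS := lamS_eq h
      have hE0 : 0 ≤ μ.real E := measureReal_nonneg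
      have hLq : 0 ≤ (L : ℝ) * lamJ lam := by positivity
      have A0 := (mul_le_mul_of_nonneg_left b0 hLq).trans a0
      have A1 := (mul_le_mul_of_nonneg_left b1 hLq).trans
        (a1.trans (mul_le_mul_of_nonneg_left p1 measureReal_nonneg))
      have A2 := (mul_le_mul_of_nonneg_left b2 hLq).trans
        (a2.trans (mul_le_mul_of_nonneg_left p2 measureReal_nonneg))
      have T := mul_le_mul_of_nonneg_left (add_le_add (add_le_add t0 t1) t2) hq.le
      push_cast
      rw [m0, m1, m2] at T
      rw [m0] at A0
      rw [m1] at A1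
      rw [m2] at A2
      rw [hS] at A0 T
      have hh' := congrArg (fun t => lamJ lam / 2 * μ.real E * t) hh
      linarith

theorem nt_zero (hμ : IsStackLaw 1 (ssrwStep 1) lam μ) (h : 0 < lam) {V : Finset (Site 1)}
    (s : State 1) (E : Set (Stacks 1)) (hE : CylE s.2 E) :
    μ.real (E ∩ {I | ¬ ∃ n u, RT V I {0} n s u}) = 0 := by
  have := hμ.1
  obtain ⟨M, hM⟩ : ∃ M : ℝ, ∀ y ∈ V, |(y 0 : ℝ)| + 1 ≤ M := by
    refine ⟨∑ y ∈ V, (|(y 0 : ℝ)| + 1), fun y hy => ?_⟩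
    exact Finset.single_le_sum (f := fun y : Site 1 => |(y 0 : ℝ)| + 1)
      (fun y _ => by positivity) hy
  have hq := lamJ_pos h
  set c := μ.real (E ∩ {I | ¬ ∃ n u, RT V I {0} n s u}) with hc
  have hc0 : 0 ≤ c := measureReal_nonneg
  by_contra hne
  have hpos : 0 < lamJ lam * c := mul_pos hq (lt_of_le_of_ne hc0 (Ne.symm hne))
  obtain ⟨L, hL⟩ := exists_nat_gt ((μ.real E * Phi V M s) / (lamJ lam * c))
  rw [div_lt_iff₀ hpos] at hL
  have := nt_bound hμ h hM L s E hE
  have h2 : c ≤ μ.real (E ∩ (FinS V (fun _ _ => True) L s)ᶜ) := by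
    refine mono_inter fun I _ hI hI' => hI ?_
    obtain ⟨n, -, u, hu, -⟩ := hI'
    exact ⟨n, u, hu⟩
  have h3 := mul_le_mul_of_nonneg_left h2 (by positivity : 0 ≤ (L : ℝ) * lamJ lam)
  linarith

end
end ARW

namespace ARW
section
open scoped Classical

variable {lam : ℝ} {μ : Measure (Stacks 1)}

/-! ### Probability that a site ends up empty -/

theorem empty_bound (hμ : IsStackLaw 1 (ssrwStep 1) lam μ) (h : 0 < lam) {V : Finset (Site 1)}
    (x : Site 1) (hx0 : x ≠ 0) (hx : x ∈ V) (L : ℕ) :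
    ∀ (s : State 1) (E : Set (Stacks 1)), CylE s.2 E → 1 ≤ numActive (s.1 x) →
      μ.real (E ∩ FinS V (fun _ u => cnt (u.1 x) = 0) L s) ≤ lamJ lam * μ.real E := by
  have := hμ.1
  have hq := lamJ_pos h
  have hthx : thr {0} x = 1 := by simp [thr, hx0]
  induction L with
  | zero =>
    intro s E hE hsx
    rw [finS_zero (fun hs => by have := hs x hx; omega)]
    simp only [Set.inter_empty, measureReal_empty]
    exact mul_nonneg hq.le measureReal_nonneg
  | succ L ih =>
    intro s E hE hsx
    by_cases hs : Nf V {0, x} s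
    · obtain ⟨E₀, E₁, E₂, c0, c1, c2, i0, i1, i2, m0, m1, m2, hsum⟩ := split hμ h s.2 E hE x
      have t1 : μ.real (E₁ ∩ FinS V (fun _ u => cnt (u.1 x) = 0) (L + 1) s) ≤ μ.real E₁ := mono_left
      have t2 : μ.real (E₂ ∩ FinS V (fun _ u => cnt (u.1 x) = 0) (L + 1) s) ≤ μ.real E₂ := mono_left
      have hsx1 : numActive (s.1 x) = 1 := by
        have := hs x hx
        simp [thr] at this
        omega
      have hfst : (toppleA V none x s).1 = Function.update s.1 x .sleeping := by
        simp [toppleA, hsx1]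
      have hnf : Nf V {0} (toppleA V none x s) := by
        intro y hy
        rw [hfst]
        by_cases hyx : y = x
        · subst hyx; simp [numActive, hthx]
        · rw [Function.update_of_ne hyx]
          have := hs y hy
          simpa [thr, hyx] using this
      have t0 : E₀ ∩ FinS V (fun _ u => cnt (u.1 x) = 0) (L + 1) s = ∅ := by
        rw [Set.eq_empty_iff_forall_notMem]
        rintro I ⟨hI, hF⟩
        obtain ⟨n, hn, u, hu, hP⟩ := finS_succ hx (by omega) (i0 I hI) hF
        rw [(hu.eq_of_nf hnf).2, hfst] at hP
        simp [cnt] at hP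
      rw [hsum, t0, measureReal_empty]
      linarith
    · obtain ⟨y, hy, hl'⟩ := not_nf hs
      have hl : thr {0} y ≤ numActive (s.1 y) := by
        refine le_trans ?_ hl'
        unfold thr
        by_cases h1 : y = 0 <;> by_cases h2 : y = x <;> simp [h1, h2, hx0]
      have hk : ∀ a, 1 ≤ numActive ((toppleA V a y s).1 x) := fun a =>
        numActive_keep V a y x s hsx (by rintro rfl; simpa [thr] using hl')
      obtain ⟨E₀, E₁, E₂, c0, c1, c2, i0, i1, i2, m0, m1, m2, hsum⟩ := split hμ h s.2 E hE y
      have b : ∀ (a : Instr 1) (E' : Set (Stacks 1)), CylE (Function.update s.2 y (s.2 y + 1)) E' →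
          (∀ I ∈ E', I (y, s.2 y) = a) →
          μ.real (E' ∩ FinS V (fun _ u => cnt (u.1 x) = 0) (L + 1) s) ≤ lamJ lam * μ.real E' :=
        fun a E' hc hi => (mono_inter fun I hI hB => finS_succ hy hl (hi I hI) hB).trans
          (ih (toppleA V a y s) E' hc (hk a))
      have b0 := b _ E₀ c0 i0
      have b1 := b _ E₁ c1 i1
      have b2 := b _ E₂ c2 i2
      rw [hsum]
      rw [m0] at b0
      rw [m1] at b1
      rw [m2] at b2
      rw [lamS_eq h] at b0
      linarith

/-! ### Return of the extra particle -/

/-- All sites at distance `< N` (except the origin) are occupied. -/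
def Occ (N : ℕ) (s : State 1) : Prop :=
  ∀ y : Site 1, y ≠ 0 → (y 0).natAbs < N → 1 ≤ cnt (s.1 y)

theorem site_ne_zero {y : Site 1} : y ≠ 0 ↔ y 0 ≠ 0 := by
  constructor
  · intro h h0
    apply h
    funext i
    rw [Subsingleton.elim i 0, h0]; rfl
  · rintro h rfl
    exact h rfl

theorem walk_bound (hμ : IsStackLaw 1 (ssrwStep 1) lam μ) (h : 0 < lam) {V : Finset (Site 1)}
    (h0 : 0 ∈ V) (N : ℕ) (hN : 1 ≤ N) (hV : ∀ y : Site 1, (y 0).natAbs < N → y ∈ V) (L : ℕ) :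
    ∀ (s : State 1) (E : Set (Stacks 1)) (p : Site 1), CylE s.2 E → (p 0).natAbs ≤ N →
      ((p 0).natAbs < N → Occ N s) →
      (p = 0 → 1 ≤ numActive (s.1 p)) →
      (p ≠ 0 → (p 0).natAbs < N → 2 ≤ numActive (s.1 p)) →
      μ.real (E ∩ FinS V (fun _ u => numActive (u.1 0) = 0) L s) ≤
        ((p 0).natAbs : ℝ) / N * μ.real E := by
  have := hμ.1
  have hq := lamJ_pos h
  have hNpos : (0 : ℝ) < N := by exact_mod_cast hN
  induction L with
  | zero =>
    intro s E p hE hpN hocc hp0 hp2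
    by_cases hp : p = 0
    · have : E ∩ FinS V (fun _ u => numActive (u.1 0) = 0) 0 s = ∅ := by
        rw [Set.eq_empty_iff_forall_notMem]
        rintro I ⟨-, n, -, u, hu, hP⟩
        have := hu.keep 0 rfl (hp ▸ hp0 hp)
        omega
      rw [this, measureReal_empty]
      positivity
    by_cases hlt : (p 0).natAbs < N
    · rw [finS_zero (fun hs => by
        have := hs p (hV p hlt)
        have h2 := hp2 hp hlt
        simp [thr, hp] at this
        omega)]
      simp only [Set.inter_empty, measureReal_empty]
      positivity
    · have e : (p 0).natAbs = N := by omega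
      rw [e, div_self hNpos.ne', one_mul]
      exact mono_left
  | succ L ih =>
    intro s E p hE hpN hocc hp0 hp2
    by_cases hp : p = 0
    · have : E ∩ FinS V (fun _ u => numActive (u.1 0) = 0) (L + 1) s = ∅ := by
        rw [Set.eq_empty_iff_forall_notMem]
        rintro I ⟨-, n, -, u, hu, hP⟩
        have := hu.keep 0 rfl (hp ▸ hp0 hp)
        omega
      rw [this, measureReal_empty]
      positivity
    by_cases hlt : (p 0).natAbs < N
    swap
    · have e : (p 0).natAbs = N := by omega
      rw [e, div_self hNpos.ne', one_mul]
      exact mono_left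
    have hpV := hV p hlt
    have h2 := hp2 hp hlt
    have hocc := hocc hlt
    have hl : thr {0} p ≤ numActive (s.1 p) := by simp [thr, hp]; omega
    obtain ⟨E₀, E₁, E₂, c0, c1, c2, i0, i1, i2, m0, m1, m2, hsum⟩ := split hμ h s.2 E hE p
    have hfst := toppleA_none_ge2 V p s h2
    have b0 : μ.real (E₀ ∩ FinS V (fun _ u => numActive (u.1 0) = 0) (L + 1) s) ≤
        ((p 0).natAbs : ℝ) / N * μ.real E₀ :=
      (mono_inter fun I hI hB => finS_succ hpV hl (i0 I hI) hB).trans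
        (ih (toppleA V none p s) E₀ p c0 hpN (fun _ y hy hyN => by rw [hfst]; exact hocc y hy hyN)
          (fun e => absurd e hp) (fun _ _ => by rw [hfst]; exact h2))
    have b : ∀ (z : Site 1) (E' : Set (Stacks 1)), CylE (Function.update s.2 p (s.2 p + 1)) E' →
        (∀ I ∈ E', I (p, s.2 p) = some z) → z ≠ 0 → ((p + z) 0).natAbs ≤ (p 0).natAbs + 1 →
        μ.real (E' ∩ FinS V (fun _ u => numActive (u.1 0) = 0) (L + 1) s) ≤
          (((p + z) 0).natAbs : ℝ) / N * μ.real E' := by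
      intro z E' hc hi hz hle
      refine (mono_inter fun I hI hB => finS_succ hpV hl (hi I hI) hB).trans
          (ih (toppleA V (some z) p s) E' (p + z) hc (by omega) ?_ ?_ ?_)
      · intro _ y hy hyN
        have e := cnt_some V z p y s (by omega) (hV y hyN)
        have o := hocc y hy hyN
        by_cases hyp : y = p
        · subst hyp
          have := numActive_le_cnt (s.1 y)
          simp only [if_true] at e
          split_ifs at e <;> omega
        · rw [if_neg hyp] at e
          split_ifs at e <;> omega
      · intro e0
        have : p + z ∈ V := e0 ▸ h0
        simp only [toppleA, if_pos this, Function.update_self, numActive_add]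
        omega
      · intro hne hltz
        have hm := hV _ hltz
        have hpz : p + z ≠ p := by simpa using hz
        simp only [toppleA, if_pos hm, Function.update_self, numActive_add]
        rw [Function.update_of_ne hpz]
        have := hocc _ hne hltz
        omega
    have b1 := b ep E₁ c1 i1 (by rw [site_ne_zero]; simp [ep]) (by simp [ep]; omega)
    have b2 := b em E₂ c2 i2 (by rw [site_ne_zero]; simp [em]) (by simp [em]; omega)
    have hpz := site_ne_zero.1 hp
    have hh : (((p + ep) 0).natAbs : ℝ) + (((p + em) 0).natAbs : ℝ) = 2 * ((p 0).natAbs : ℝ) := by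
      have : ((p + ep) 0).natAbs + ((p + em) 0).natAbs = 2 * (p 0).natAbs := by
        simp [ep, em]; omega
      exact_mod_cast this
    rw [hsum]
    rw [m0, lamS_eq h] at b0
    rw [m1] at b1
    rw [m2] at b2
    have hh' := congrArg (fun t => t / N * (lamJ lam / 2 * μ.real E)) hh
    simp only [add_div, add_mul] at hh'
    have : 2 * ((p 0).natAbs : ℝ) / N * (lamJ lam / 2 * μ.real E) =
      ((p 0).natAbs : ℝ) / N * (lamJ lam * μ.real E) := by ring
    rw [this] at hh'
    have e3 : ((p 0).natAbs : ℝ) / N * ((1 - lamJ lam) * μ.real E) =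
      ((p 0).natAbs : ℝ) / N * μ.real E - ((p 0).natAbs : ℝ) / N * (lamJ lam * μ.real E) := by ring
    linarith

/-- No return to the origin. -/
def NoRet (V : Finset (Site 1)) (s : State 1) : Set (Stacks 1) :=
  {I | ∀ n v, RT V I {0} n s v → numActive (v.1 0) = 0}

theorem noRet_bound (hμ : IsStackLaw 1 (ssrwStep 1) lam μ) (h : 0 < lam) {V : Finset (Site 1)}
    (s : State 1) (E : Set (Stacks 1)) (hE : CylE s.2 E) (c : ℝ)
    (hc : ∀ L, μ.real (E ∩ FinS V (fun _ u => numActive (u.1 0) = 0) L s) ≤ c) :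
    μ.real (E ∩ NoRet V s) ≤ c := by
  have := hμ.1
  have h1 := finS_limit s E c hc
  have h2 := nt_zero hμ h (V := V) s E hE
  have h3 : E ∩ NoRet V s ⊆ (E ∩ {I | ∃ n u, RT V I {0} n s u ∧ numActive (u.1 0) = 0}) ∪
      (E ∩ {I | ¬ ∃ n u, RT V I {0} n s u}) := by
    rintro I ⟨hI, hR⟩
    by_cases hn : ∃ n u, RT V I {0} n s u
    · obtain ⟨n, u, hu⟩ := hn
      exact Or.inl ⟨hI, n, u, hu, hR n u hu⟩
    · exact Or.inr ⟨hI, hn⟩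
  have h4 := (measureReal_mono (μ := μ) h3).trans (measureReal_union_le _ _)
  linarith

theorem jump_bound (hμ : IsStackLaw 1 (ssrwStep 1) lam μ) (h : 0 < lam) {V : Finset (Site 1)}
    (h0 : 0 ∈ V) (N : ℕ) (hN : 1 ≤ N) (hV : ∀ y : Site 1, (y 0).natAbs < N → y ∈ V) (L : ℕ) :
    ∀ (s : State 1) (E : Set (Stacks 1)), CylE s.2 E → Occ N s → 1 ≤ numActive (s.1 0) →
      μ.real (E ∩ {I | JBad V I s}) ≤ (1 / N + lamS lam ^ L) * μ.real E := by
  have := hμ.1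
  have hq := lamJ_pos h
  have hNpos : (0 : ℝ) < N := by exact_mod_cast hN
  induction L with
  | zero =>
    intro s E hE hocc hs0
    refine mono_left.trans ?_
    have : (0 : ℝ) ≤ 1 / N * μ.real E := by positivity
    rw [pow_zero]; linarith
  | succ L ih =>
    intro s E hE hocc hs0
    obtain ⟨E₀, E₁, E₂, c0, c1, c2, i0, i1, i2, m0, m1, m2, hsum⟩ := split hμ h s.2 E hE 0
    have b0 : μ.real (E₀ ∩ {I | JBad V I s}) ≤ (1 / N + lamS lam ^ L) * μ.real E₀ := by
      refine (mono_inter fun I hI hB => ?_).trans (ih (bump s) E₀ c0 hocc hs0)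
      have hn := i0 I hI
      by_cases hall : ∀ k, I (0, s.2 0 + k) = none
      · refine Or.inl fun k => ?_
        have := hall (k + 1)
        rw [show s.2 0 + (k + 1) = s.2 0 + 1 + k by ring] at this
        simpa [bump] using this
      · rcases hB with hB | hB
        · exact absurd hB hall
        · right
          push Not at hall
          rw [← jumpOut_none s hn hall]
          exact hB
    have b : ∀ (z : Site 1) (E' : Set (Stacks 1)), CylE (Function.update s.2 0 (s.2 0 + 1)) E' →
        (∀ I ∈ E', I (0, s.2 0) = some z) → z ≠ 0 → (z 0).natAbs = 1 →
        μ.real (E' ∩ {I | JBad V I s}) ≤ 1 / N * μ.real E' := by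
      intro z E' hc hi hz hz1
      have hcc : CylE (toppleA V (some z) 0 s).2 E' := hc
      refine (mono_inter (B' := NoRet V (toppleA V (some z) 0 s)) fun I hI hB => ?_).trans
        (noRet_bound hμ h _ E' hcc _ fun L => ?_)
      · have hn := i0
        rcases hB with hB | hB
        · have := hB 0
          rw [add_zero, hi I hI] at this
          simp at this
        · rw [jumpOut_some s z (hi I hI), topple_eq, hi I hI] at hB
          exact hB
      · have w := walk_bound hμ h h0 N hN hV L (toppleA V (some z) 0 s) E' z hcc (by omega) ?_ ?_ ?_
        · rwa [hz1, Nat.cast_one] at w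
        · intro _ y hy hyN
          have e := cnt_some V z 0 y s hs0 (hV y hyN)
          have o := hocc y hy hyN
          rw [if_neg hy] at e
          split_ifs at e <;> omega
        · exact fun e => absurd e hz
        · intro _ hlt
          have hm : (0 : Site 1) + z ∈ V := by rw [zero_add]; exact hV z hlt
          have o := hocc z hz hlt
          simp only [toppleA, if_pos hm]
          rw [zero_add, Function.update_self, numActive_add, Function.update_of_ne hz]
          omega
    have b1 := b ep E₁ c1 i1 (by rw [site_ne_zero]; simp [ep]) (by simp [ep])
    have b2 := b em E₂ c2 i2 (by rw [site_ne_zero]; simp [em]) (by simp [em])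
    rw [hsum]
    rw [m0] at b0
    rw [m1] at b1
    rw [m2] at b2
    have e3 : (1 / (N : ℝ) + lamS lam ^ L) * (lamS lam * μ.real E) =
      lamS lam * (1 / N * μ.real E) + lamS lam ^ (L + 1) * μ.real E := by ring
    have e4 : lamS lam * (1 / N * μ.real E) =
      (1 / N * μ.real E) - lamJ lam * (1 / N * μ.real E) := by rw [lamS_eq h]; ring
    linarith

theorem jump_bound' (hμ : IsStackLaw 1 (ssrwStep 1) lam μ) (h : 0 < lam) {V : Finset (Site 1)}
    (h0 : 0 ∈ V) (N : ℕ) (hN : 1 ≤ N) (hV : ∀ y : Site 1, (y 0).natAbs < N → y ∈ V)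
    (s : State 1) (E : Set (Stacks 1)) (hE : CylE s.2 E) (ho : Occ N s)
    (h1 : 1 ≤ numActive (s.1 0)) :
      μ.real (E ∩ {I | JBad V I s}) ≤ 1 / N * μ.real E := by
  have hlim : Tendsto (fun L : ℕ => (1 / (N : ℝ) + lamS lam ^ L) * μ.real E) atTop
      (𝓝 ((1 / N + 0) * μ.real E)) := by
    refine Tendsto.mul_const _ (Tendsto.const_add _ ?_)
    refine tendsto_pow_atTop_nhds_zero_of_lt_one (lamS_pos h).le ?_
    rw [lamS_eq h]; linarith [lamJ_pos h]
  rw [add_zero] at hlim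
  exact ge_of_tendsto' hlim fun L => jump_bound hμ h h0 N hN hV L s E hE ho h1

/-- Sites at distance between `1` and `R`. -/
noncomputable def pts (R : ℕ) : Finset (Site 1) :=
  ((Finset.Icc (-(R : ℤ)) R).erase 0).image (fun k => fun _ => k)

theorem mem_pts {R : ℕ} {y : Site 1} : y ∈ pts R ↔ y ≠ 0 ∧ (y 0).natAbs ≤ R := by
  simp only [pts, Finset.mem_image, Finset.mem_erase, Finset.mem_Icc]
  constructor
  · rintro ⟨k, hk, rfl⟩
    exact ⟨site_ne_zero.2 hk.1, by simp only; omega⟩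
  · rintro ⟨h1, h2⟩
    refine ⟨y 0, ⟨site_ne_zero.1 h1, by omega, by omega⟩, ?_⟩
    funext i
    rw [Subsingleton.elim i 0]

theorem main_bound (hμ : IsStackLaw 1 (ssrwStep 1) lam μ) (h : 0 < lam) {V : Finset (Site 1)}
    (R : ℕ) (hV : ∀ y : Site 1, (y 0).natAbs ≤ R → y ∈ V) (L : ℕ) :
    ∀ (s : State 1) (E : Set (Stacks 1)), CylE s.2 E → 1 ≤ numActive (s.1 0) →
      μ.real (E ∩ FinS V (fun I u => JBad V I u) L s) ≤ 1 / (R + 1 : ℝ) * μ.real E +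
        ∑ x ∈ pts R, 1 / ((x 0).natAbs : ℝ) *
          μ.real (E ∩ FinS V (fun _ u => cnt (u.1 x) = 0) L s) := by
  have := hμ.1
  have h0 : (0 : Site 1) ∈ V := hV 0 (by simp)
  have normal : ∀ (L : ℕ) (s : State 1) (E : Set (Stacks 1)), CylE s.2 E →
      1 ≤ numActive (s.1 0) → Nf V {0} s →
      μ.real (E ∩ FinS V (fun I u => JBad V I u) L s) ≤ 1 / (R + 1 : ℝ) * μ.real E +
        ∑ x ∈ pts R, 1 / ((x 0).natAbs : ℝ) *
          μ.real (E ∩ FinS V (fun _ u => cnt (u.1 x) = 0) L s) := by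
    intro L s E hE hs0 hs
    have h1 : μ.real (E ∩ FinS V (fun I u => JBad V I u) L s) ≤ μ.real (E ∩ {I | JBad V I s}) := by
      refine mono_inter fun I hI hB => ?_
      obtain ⟨n, hn, u, hu, hP⟩ := hB
      rw [(hu.eq_of_nf hs).2] at hP
      exact hP
    refine h1.trans ?_
    have hnn : ∀ x ∈ pts R, 0 ≤ 1 / ((x 0).natAbs : ℝ) *
          μ.real (E ∩ FinS V (fun _ u => cnt (u.1 x) = 0) L s) := fun x _ => by positivity
    by_cases hocc : Occ (R + 1) s
    · have := jump_bound' hμ h h0 (R + 1) (by omega) (fun y hy => hV y (by omega)) s E hE hocc hs0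
      push_cast at this
      have h2 := Finset.sum_nonneg hnn
      linarith
    · have hex : ∃ k, ∃ y : Site 1, y ∈ pts R ∧ (y 0).natAbs = k ∧ cnt (s.1 y) = 0 := by
        unfold Occ at hocc
        push Not at hocc
        obtain ⟨y, hy0, hyR, hc⟩ := hocc
        exact ⟨_, y, mem_pts.2 ⟨hy0, by omega⟩, rfl, by omega⟩
      obtain ⟨y, hy, hyN, hc⟩ := Nat.find_spec hex
      have hmin := fun m => @Nat.find_min _ _ hex m
      generalize Nat.find hex = N at hyN hmin
      have hy' := mem_pts.1 hy
      have hy0 := site_ne_zero.1 hy'.1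
      have hoN : Occ N s := by
        intro w hw hwN
        by_contra hcw
        exact hmin _ hwN ⟨w, mem_pts.2 ⟨hw, by omega⟩, rfl, by omega⟩
      have := jump_bound' hμ h h0 N (by omega) (fun y hy => hV y (by omega)) s E hE hoN hs0
      have h2 := Finset.single_le_sum hnn hy
      have h3 : FinS V (fun _ u => cnt (u.1 y) = 0) L s = Set.univ := by
        rw [Set.eq_univ_iff_forall]
        exact fun I => ⟨0, by omega, s, RT.zero s hs, hc⟩
      rw [h3, Set.inter_univ, hyN] at h2
      have h4 : 0 ≤ 1 / (R + 1 : ℝ) * μ.real E := by positivity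
      linarith
  induction L with
  | zero =>
    intro s E hE hs0
    by_cases hs : Nf V {0} s
    · exact normal 0 s E hE hs0 hs
    · rw [finS_zero hs]
      simp only [Set.inter_empty, measureReal_empty]
      have : 0 ≤ 1 / (R + 1 : ℝ) * μ.real E := by positivity
      refine add_nonneg this (Finset.sum_nonneg fun x _ => by positivity)
  | succ L ih =>
    intro s E hE hs0
    by_cases hs : Nf V {0} s
    · exact normal (L + 1) s E hE hs0 hs
    · obtain ⟨y, hy, hl⟩ := not_nf hs
      have hk : ∀ a, 1 ≤ numActive ((toppleA V a y s).1 0) := fun a =>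
        numActive_keep V a y 0 s hs0 (by rintro rfl; simpa [thr] using hl)
      obtain ⟨E₀, E₁, E₂, c0, c1, c2, i0, i1, i2, m0, m1, m2, hsum⟩ := split hμ h s.2 E hE y
      have b : ∀ (a : Instr 1) (E' : Set (Stacks 1)), CylE (Function.update s.2 y (s.2 y + 1)) E' →
          (∀ I ∈ E', I (y, s.2 y) = a) →
          μ.real (E' ∩ FinS V (fun I u => JBad V I u) (L + 1) s) ≤ 1 / (R + 1 : ℝ) * μ.real E' +
          ∑ x ∈ pts R, 1 / ((x 0).natAbs : ℝ) *
            μ.real (E' ∩ FinS V (fun _ u => cnt (u.1 x) = 0) (L + 1) s) := by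
        intro a E' hc hi
        refine (mono_inter fun I hI hB => finS_succ hy hl (hi I hI) hB).trans
          ((ih (toppleA V a y s) E' hc (hk a)).trans ?_)
        refine add_le_add le_rfl (Finset.sum_le_sum fun x hx =>
          mul_le_mul_of_nonneg_left ?_ (by positivity))
        exact mono_inter fun I hI hB => finS_pred hy hl (hi I hI) hB
      have b0 := b _ E₀ c0 i0
      have b1 := b _ E₁ c1 i1
      have b2 := b _ E₂ c2 i2
      have hs' : ∑ x ∈ pts R, 1 / ((x 0).natAbs : ℝ) *
            μ.real (E ∩ FinS V (fun _ u => cnt (u.1 x) = 0) (L + 1) s) =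
          ∑ x ∈ pts R, 1 / ((x 0).natAbs : ℝ) *
            μ.real (E₀ ∩ FinS V (fun _ u => cnt (u.1 x) = 0) (L + 1) s) +
          ∑ x ∈ pts R, 1 / ((x 0).natAbs : ℝ) *
            μ.real (E₁ ∩ FinS V (fun _ u => cnt (u.1 x) = 0) (L + 1) s) +
          ∑ x ∈ pts R, 1 / ((x 0).natAbs : ℝ) *
            μ.real (E₂ ∩ FinS V (fun _ u => cnt (u.1 x) = 0) (L + 1) s) := by
        rw [← Finset.sum_add_distrib, ← Finset.sum_add_distrib]
        refine Finset.sum_congr rfl fun x _ => ?_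
        rw [hsum]; ring
      rw [hs', hsum]
      rw [m0, lamS_eq h] at b0
      rw [m1] at b1
      rw [m2] at b2
      linarith

theorem sum_pts (R : ℕ) : ∑ x ∈ pts R, 1 / ((x 0).natAbs : ℝ) ≤ 2 * (1 + Real.log R) := by
  have e : pts R = (Finset.Icc 1 R).image (fun k : ℕ => (fun _ => (k : ℤ) : Site 1)) ∪
      (Finset.Icc 1 R).image (fun k : ℕ => (fun _ => -(k : ℤ) : Site 1)) := by
    ext y
    simp only [mem_pts, Finset.mem_union, Finset.mem_image, Finset.mem_Icc]
    constructor
    · rintro ⟨h1, h2⟩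
      have h1' := site_ne_zero.1 h1
      rcases le_total 0 (y 0) with hy | hy
      · left
        refine ⟨(y 0).natAbs, by omega, ?_⟩
        funext i
        rw [Subsingleton.elim i 0]; omega
      · right
        refine ⟨(y 0).natAbs, by omega, ?_⟩
        funext i
        rw [Subsingleton.elim i 0]; omega
    · rintro (⟨k, hk, rfl⟩ | ⟨k, hk, rfl⟩)
      · exact ⟨site_ne_zero.2 (show (k : ℤ) ≠ 0 by omega), show ((k : ℤ)).natAbs ≤ R by omega⟩
      · exact ⟨site_ne_zero.2 (show -(k : ℤ) ≠ 0 by omega), show (-(k : ℤ)).natAbs ≤ R by omega⟩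
  have hh : ∑ k ∈ Finset.Icc 1 R, 1 / (k : ℝ) ≤ 1 + Real.log R := by
    have := harmonic_le_one_add_log R
    rw [harmonic_eq_sum_Icc] at this
    push_cast at this
    simpa using this
  have hnn : ∀ x : Site 1, 0 ≤ 1 / ((x 0).natAbs : ℝ) := fun x => by positivity
  rw [e]
  have h1 := Finset.sum_union_inter
    (s₁ := (Finset.Icc 1 R).image (fun k : ℕ => (fun _ => (k : ℤ) : Site 1)))
    (s₂ := (Finset.Icc 1 R).image (fun k : ℕ => (fun _ => -(k : ℤ) : Site 1)))
    (f := fun x : Site 1 => 1 / ((x 0).natAbs : ℝ))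
  have h2 := Finset.sum_nonneg (s := (Finset.Icc 1 R).image (fun k : ℕ => (fun _ => (k : ℤ) : Site 1))
    ∩ (Finset.Icc 1 R).image (fun k : ℕ => (fun _ => -(k : ℤ) : Site 1)))
    (f := fun x : Site 1 => 1 / ((x 0).natAbs : ℝ)) (fun x _ => hnn x)
  rw [Finset.sum_image, Finset.sum_image] at h1
  · simp only [Int.natAbs_natCast, Int.natAbs_neg] at h1
    linarith
  · intro a _ b _ hab
    have := congrFun hab 0
    simpa using this
  · intro a _ b _ hab
    have := congrFun hab 0
    simpa using this

end
end ARW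

theorem arw_dim1_chances_eq_one_bound :
    ∃ C > (0 : ℝ), ∃ lam₀ > (1 : ℝ), ∀ lam ≥ lam₀,
      ∀ V : Finset (Site 1), ball 1 lam ⊆ ↑V → ∀ η : Site 1 → ℕ, Fills η (ball 1 lam) →
        stackLaw 1 (ssrwStep 1) lam {I | chances V I η = 1} ≤
          ENNReal.ofReal (C * (Real.log lam / lam)) := by
  refine ⟨5, by norm_num, 3, by norm_num, ?_⟩
  intro lam hlam3 V hBV η hη
  have hlam : 0 < lam := by linarith
  by_cases hex : ∃ μ, IsStackLaw 1 (ssrwStep 1) lam μ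
  swap
  · simp [stackLaw, hex]
  have hμ : IsStackLaw 1 (ssrwStep 1) lam (stackLaw 1 (ssrwStep 1) lam) := by
    simp only [stackLaw, dif_pos hex]
    exact hex.choose_spec
  generalize stackLaw 1 (ssrwStep 1) lam = μ at hμ
  have := hμ.1
  have hball : ∀ y : Site 1, (y 0).natAbs ≤ ⌊lam⌋₊ → y ∈ ball 1 lam := by
    intro y hy
    have : ((y 0).natAbs : ℝ) ≤ lam := (Nat.cast_le.2 hy).trans (Nat.floor_le hlam.le)
    simpa [ball] using this
  have hV : ∀ y : Site 1, (y 0).natAbs ≤ ⌊lam⌋₊ → y ∈ V := fun y hy => hBV (hball y hy)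
  have hact : ∀ y : Site 1, (y 0).natAbs ≤ ⌊lam⌋₊ → 1 ≤ numActive ((initState 1 V η).1 y) := by
    intro y hy
    simp only [initState, if_pos (hV y hy), numActive_active]
    exact hη y (hball y hy)
  have h0 : (0 : Site 1) ∈ V := hV 0 (by simp)
  set s := initState 1 V η with hs
  have hcyl : CylE s.2 Set.univ := ⟨∅, fun _ => none, by simp, by simp⟩
  have hnt := nt_zero hμ hlam (V := V) s Set.univ hcyl
  rw [Set.univ_inter] at hnt
  have hlog3 : 1 ≤ Real.log lam := by
    rw [Real.le_log_iff_exp_le hlam]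
    linarith [Real.exp_one_lt_d9]
  have hR : lam < (⌊lam⌋₊ : ℝ) + 1 := Nat.lt_floor_add_one lam
  have hqle : lamJ lam ≤ 1 / lam := by
    unfold lamJ
    exact one_div_le_one_div_of_le hlam (by linarith)
  have hmain : μ.real (Set.univ ∩ {I | ∃ n u, RT V I {0} n s u ∧ JBad V I u}) ≤
      5 * (Real.log lam / lam) := by
    refine finS_limit s Set.univ _ fun L => ?_
    refine (main_bound hμ hlam ⌊lam⌋₊ hV L s Set.univ hcyl (hact 0 (by simp))).trans ?_
    have hsum : ∑ x ∈ pts ⌊lam⌋₊, 1 / ((x 0).natAbs : ℝ) *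
          μ.real (Set.univ ∩ FinS V (fun _ u => cnt (u.1 x) = 0) L s) ≤
        ∑ x ∈ pts ⌊lam⌋₊, 1 / ((x 0).natAbs : ℝ) * (1 / lam) := by
      refine Finset.sum_le_sum fun x hx => ?_
      obtain ⟨hx0, hxR⟩ := mem_pts.1 hx
      have := empty_bound hμ hlam x hx0 (hV x hxR) L s Set.univ hcyl (hact x hxR)
      rw [probReal_univ, mul_one] at this
      exact mul_le_mul_of_nonneg_left (this.trans hqle) (by positivity)
    rw [← Finset.sum_mul] at hsum
    have h1 := sum_pts ⌊lam⌋₊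
    have h2 : Real.log (⌊lam⌋₊ : ℝ) ≤ Real.log lam := by
      refine Real.log_le_log ?_ (Nat.floor_le hlam.le)
      exact_mod_cast Nat.floor_pos.2 (by linarith)
    have h3 : (∑ x ∈ pts ⌊lam⌋₊, 1 / ((x 0).natAbs : ℝ)) * (1 / lam) ≤
        (2 * (1 + Real.log lam)) * (1 / lam) :=
      mul_le_mul_of_nonneg_right (by linarith) (by positivity)
    have h4 : 1 / ((⌊lam⌋₊ : ℝ) + 1) ≤ 1 / lam := one_div_le_one_div_of_le hlam hR.le
    rw [probReal_univ, mul_one]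
    have h5 : 1 * (1 / lam) ≤ Real.log lam * (1 / lam) :=
      mul_le_mul_of_nonneg_right hlog3 (by positivity)
    have h6 : Real.log lam / lam = Real.log lam * (1 / lam) := by ring
    rw [h6]
    linarith
  rw [Set.univ_inter] at hmain
  have hsub : {I | chances V I η = 1} ⊆ {I | ¬ ∃ n u, RT V I {0} n s u} ∪
      {I | ∃ n u, RT V I {0} n s u ∧ JBad V I u} := fun I hI => chances_one h0 η hI
  have hle := (measureReal_mono (μ := μ) hsub).trans (measureReal_union_le _ _)
  rw [← ENNReal.ofReal_toReal (measure_ne_top μ {I | chances V I η = 1})]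
  refine ENNReal.ofReal_le_ofReal ?_
  change μ.real _ ≤ _
  linarith
end
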